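/- arXiv:1205.6395 — 5 statements merged into one kernel-verified Lean document; each statement's English description precedes it below -/
import Mathlib

section
/- For every real ε > 0 there exists an integer v0 such that for every integer v > v0 with v ≡ 1 (mod 3), there exists a 2-(v,4,1) directed design (which has v(v−1)/6 blocks) whose smallest defining sets contain at least (5/8 − c/v)·(v(v−1)/6) blocks, where c = 13/8 + ε. -/
open scoped Classical

/-- A block of size `k` on the point set `α`: a list of `k` distinct points. -/
def IsBlock {α : Type*} (k : ℕ) (b : List α) : Prop :=
  b.Nodup ∧ b.length = k

/-- A `t-(v,k,λ)` directed design whose point set is the whole (finite) type `α`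
(so `v = Fintype.card α`): every ordered `t`-tuple of distinct points appears,
as a subsequence, in exactly `lam` blocks of the multiset `B`. -/
def IsDD {α : Type*} (t k lam : ℕ) (B : Multiset (List α)) : Prop :=
  (∀ b ∈ B, IsBlock k b) ∧
    ∀ s : List α, s.Nodup → s.length = t →
      B.countP (fun b => s.Sublist b) = lam

/-- `S` is a defining set of the `t-(v,k,λ)` directed design with block multiset `B`:
`S` is a sub-multiset of `B`, and `B` is the unique block multiset of a
`t-(v,k,λ)DD` on the same point set containing `S`. -/
def IsDefiningSet {α : Type*} (t k lam : ℕ) (B S : Multiset (List α)) : Prop :=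
  S ≤ B ∧ ∀ B' : Multiset (List α), IsDD t k lam B' → S ≤ B' → B' = B

/-- A `(v,k,t)` directed trade `T₁ - T₂` of volume `s` on the point set `α`. -/
def IsTrade {α : Type*} (t k s : ℕ) (T₁ T₂ : Multiset (List α)) : Prop :=
  1 ≤ s ∧ Multiset.card T₁ = s ∧ Multiset.card T₂ = s ∧
    (∀ b ∈ T₁, IsBlock k b) ∧ (∀ b ∈ T₂, IsBlock k b) ∧
    (∀ b, b ∈ T₁ → b ∉ T₂) ∧
    ∀ l : List α, l.Nodup → l.length = t →
      T₁.countP (fun b => l.Sublist b) = T₂.countP (fun b => l.Sublist b)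

/-- A multiset of blocks is super-simple if any two blocks (any sub-multiset
consisting of two blocks) intersect, as point sets, in at most two points. -/
def SuperSimple {α : Type*} (B : Multiset (List α)) : Prop :=
  ∀ b₁ b₂ : List α, ({b₁, b₂} : Multiset (List α)) ≤ B →
    (b₁.toFinset ∩ b₂.toFinset).card ≤ 2

/-- A `2-(v,K,1)` design (pairwise balanced design) on the point type `β`. -/
def IsPBD {β : Type*} (K : Set ℕ) (D : Multiset (Finset β)) : Prop :=
  (∀ b ∈ D, b.card ∈ K) ∧
    ∀ x y : β, x ≠ y → D.countP (fun b => x ∈ b ∧ y ∈ b) = 1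

/-- A `{K}`-GDD on the point type `β` with group multiset `Gs` and block multiset `Bs`. -/
def IsGDD {β : Type*} (K : Set ℕ) (Gs Bs : Multiset (Finset β)) : Prop :=
  (∀ x : β, Gs.countP (fun G => x ∈ G) = 1) ∧
    (∀ b ∈ Bs, b.card ∈ K) ∧
    (∀ b ∈ Bs, ∀ G ∈ Gs, (b ∩ G).card ≤ 1) ∧
    (∀ x y : β, x ≠ y → (∀ G ∈ Gs, ¬(x ∈ G ∧ y ∈ G)) →
      Bs.countP (fun b => x ∈ b ∧ y ∈ b) = 1)

/-- A `4`-DGDD on the point type `β` with group multiset `Gs` and block multiset `B`: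
the groups partition the points, no block meets a group twice, and every ordered pair
of points from distinct groups appears in exactly one block. -/
def IsDGDD {β : Type*} (Gs : Multiset (Finset β)) (B : Multiset (List β)) : Prop :=
  (∀ x : β, Gs.countP (fun G => x ∈ G) = 1) ∧
    (∀ b ∈ B, IsBlock 4 b) ∧
    (∀ b ∈ B, ∀ G ∈ Gs, (b.toFinset ∩ G).card ≤ 1) ∧
    (∀ x y : β, x ≠ y → (∀ G ∈ Gs, ¬(x ∈ G ∧ y ∈ G)) →
      B.countP (fun b => [x, y].Sublist b) = 1)

/-- `S` is a defining set of the `4`-DGDD with groups `Gs` and block multiset `B`. -/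
def IsDGDDDefiningSet {β : Type*} (Gs : Multiset (Finset β)) (B S : Multiset (List β)) : Prop :=
  S ≤ B ∧ ∀ B' : Multiset (List β), IsDGDD Gs B' → S ≤ B' → B' = B

/-- `B` is a multiset of blocks of size four in which the ordered pair `(x, y)` of distinct points
appears exactly once if `Q x y` holds, and never otherwise. -/
def Covers {α : Type*} (B : Multiset (List α)) (Q : α → α → Prop) : Prop :=
  (∀ b ∈ B, IsBlock 4 b) ∧
    ∀ x y : α, x ≠ y → B.countP (fun b => [x, y].Sublist b) = if Q x y then 1 else 0

theorem pair_sublist_append {α : Type*} {x y : α} {l₁ l₂ : List α} :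
    [x, y].Sublist (l₁ ++ l₂) ↔
      [x, y].Sublist l₁ ∨ (x ∈ l₁ ∧ y ∈ l₂) ∨ [x, y].Sublist l₂ := by
  induction l₁ with
  | nil => simp
  | cons a l ih =>
    simp only [List.cons_append, List.cons_sublist_cons', ih, List.singleton_sublist,
      List.mem_append, List.mem_cons]
    grind

theorem pair_sublist_four {α : Type*} {x y a b c d : α} :
    [x, y].Sublist [a, b, c, d] ↔ (x = a ∧ y = b) ∨ (x = a ∧ y = c) ∨ (x = a ∧ y = d) ∨
      (x = b ∧ y = c) ∨ (x = b ∧ y = d) ∨ (x = c ∧ y = d) := by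
  simp only [List.cons_sublist_cons', List.sublist_nil]
  simp
  grind

theorem IsBlock.exists_four {α : Type*} {b : List α} (hb : IsBlock 4 b) :
    ∃ p q r s, b = [p, q, r, s] ∧ p ≠ q ∧ p ≠ r ∧ p ≠ s ∧ q ≠ r ∧ q ≠ s ∧ r ≠ s := by
  obtain ⟨hn, hl⟩ := hb
  obtain ⟨p, q, r, s, rfl⟩ : ∃ p q r s, b = [p, q, r, s] := by
    match b, hl with
    | [p, q, r, s], _ => exact ⟨p, q, r, s, rfl⟩
  simp at hn
  exact ⟨p, q, r, s, rfl, by tauto⟩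

namespace Covers

variable {α β : Type*} {B : Multiset (List α)} {Q : α → α → Prop}

theorem rel_of_sublist (h : Covers B Q) {b : List α} (hb : b ∈ B) {x y : α}
    (hxy : [x, y].Sublist b) : Q x y := by
  have hne : x ≠ y := by
    have := hxy.nodup (h.1 b hb).1
    simpa using this
  have h1 := h.2 x y hne
  by_contra hQ
  rw [if_neg hQ, Multiset.countP_eq_zero] at h1
  exact h1 b hb hxy

theorem congr (h : Covers B Q) {Q' : α → α → Prop} (hQ : ∀ x y, x ≠ y → (Q x y ↔ Q' x y)) :
    Covers B Q' :=
  ⟨h.1, fun x y hxy => by rw [h.2 x y hxy]; simp [hQ x y hxy]⟩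

theorem mem_of_mem (h : Covers B Q) {V : Set α} (hV : ∀ x y, Q x y → x ∈ V ∧ y ∈ V)
    {b : List α} (hb : b ∈ B) {x : α} (hx : x ∈ b) : x ∈ V := by
  obtain ⟨p, q, r, s, rfl, -⟩ := (h.1 b hb).exists_four
  have h1 := hV p q (h.rel_of_sublist hb (by simp))
  have h2 := hV r s (h.rel_of_sublist hb (by simp))
  simp only [List.mem_cons, List.not_mem_nil, or_false] at hx
  rcases hx with rfl | rfl | rfl | rfl <;> tauto

theorem map (h : Covers B Q) {V : Set α} (hV : ∀ x y, Q x y → x ∈ V ∧ y ∈ V) {f : α → β}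
    (hf : Set.InjOn f V) :
    Covers (B.map (List.map f)) (fun x' y' => ∃ x y, f x = x' ∧ f y = y' ∧ Q x y) := by
  refine ⟨?_, ?_⟩
  · intro b hb
    obtain ⟨b, hbB, rfl⟩ := Multiset.mem_map.1 hb
    refine ⟨(List.nodup_map_iff_inj_on (h.1 b hbB).1).2 fun x hx y hy hxy =>
      hf (h.mem_of_mem hV hbB hx) (h.mem_of_mem hV hbB hy) hxy, ?_⟩
    simpa using (h.1 b hbB).2
  · intro x' y' hne
    rw [Multiset.countP_map, ← Multiset.countP_eq_card_filter]
    have key : ∀ b ∈ B, [x', y'].Sublist (b.map f) →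
        ∃ x y, f x = x' ∧ f y = y' ∧ [x, y].Sublist b := by
      intro b hb hs
      obtain ⟨l, hl, he⟩ := List.sublist_map_iff.1 hs
      match l, he with
      | [x, y], he =>
        simp at he
        exact ⟨x, y, he.1.symm, he.2.symm, hl⟩
    split_ifs with hQ
    · obtain ⟨x, y, rfl, rfl, hQ⟩ := hQ
      have hxy : x ≠ y := fun e => hne (by rw [e])
      have := h.2 x y hxy
      rw [if_pos hQ] at this
      rw [← this]
      refine Multiset.countP_congr rfl fun b hb => propext ⟨fun hs => ?_, fun hs => ?_⟩
      · obtain ⟨x₁, y₁, hx, hy, hs⟩ := key b hb hs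
        have hm : x₁ ∈ b ∧ y₁ ∈ b := by
          constructor <;> apply hs.subset <;> simp
        rwa [← hf (h.mem_of_mem hV hb hm.1) (hV _ _ hQ).1 hx,
          ← hf (h.mem_of_mem hV hb hm.2) (hV _ _ hQ).2 hy]
      · exact hs.map f
    · rw [Multiset.countP_eq_zero]
      intro b hb hs
      obtain ⟨x, y, hx, hy, hs⟩ := key b hb hs
      exact hQ ⟨x, y, hx, hy, h.rel_of_sublist hb hs⟩

theorem map_injective (h : Covers B Q) {f : α → β} (hf : Function.Injective f) :
    Covers (B.map (List.map f)) (fun x' y' => ∃ x y, f x = x' ∧ f y = y' ∧ Q x y) :=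
  h.map (V := Set.univ) (fun _ _ _ => ⟨trivial, trivial⟩) hf.injOn

theorem add (h : Covers B Q) {B' : Multiset (List α)} {Q' : α → α → Prop} (h' : Covers B' Q')
    (hd : ∀ x y, x ≠ y → Q x y → ¬ Q' x y) : Covers (B + B') (fun x y => Q x y ∨ Q' x y) := by
  refine ⟨fun b hb => ?_, fun x y hxy => ?_⟩
  · rcases Multiset.mem_add.1 hb with hb | hb
    exacts [h.1 b hb, h'.1 b hb]
  · rw [Multiset.countP_add, h.2 x y hxy, h'.2 x y hxy]
    have := hd x y hxy
    by_cases h1 : Q x y <;> by_cases h2 : Q' x y <;> simp_all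

theorem sum {ι : Type*} (s : Finset ι) (M : ι → Multiset (List α)) (R : ι → α → α → Prop)
    (h : ∀ i ∈ s, Covers (M i) (R i))
    (hd : ∀ x y, x ≠ y → ∀ i ∈ s, ∀ j ∈ s, R i x y → R j x y → i = j) :
    Covers (∑ i ∈ s, M i) (fun x y => ∃ i ∈ s, R i x y) := by
  induction s using Finset.induction_on with
  | empty => exact ⟨by simp, by simp⟩
  | insert a s ha ih =>
    rw [Finset.sum_insert ha]
    refine ((h a (by simp)).add (ih (fun i hi => h i (by simp [hi])) fun x y hxy i hi j hj =>
      hd x y hxy i (by simp [hi]) j (by simp [hj])) ?_).congr ?_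
    · rintro x y hxy h1 ⟨i, hi, h2⟩
      exact ha (hd x y hxy a (by simp) i (by simp [hi]) h1 h2 ▸ hi)
    · simp

theorem isDD (h : Covers B fun _ _ => True) : IsDD 2 4 1 B := by
  refine ⟨h.1, fun s hs hl => ?_⟩
  obtain ⟨x, y, rfl⟩ := List.length_eq_two.1 hl
  simpa using h.2 x y (by simpa using hs)

end Covers

theorem Covers.card_eq {α : Type*} [Fintype α] {B : Multiset (List α)}
    (h : Covers B fun _ _ => True) :
    6 * Multiset.card B = Fintype.card α * (Fintype.card α - 1) := by
  have h1 : ∑ p ∈ (Finset.univ : Finset α).offDiag,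
      B.countP (fun b => [p.1, p.2].Sublist b) = Fintype.card α * (Fintype.card α - 1) := by
    rw [Finset.sum_congr rfl fun p hp => h.2 p.1 p.2 (Finset.mem_offDiag.1 hp).2.2]
    simp [Finset.offDiag_card, Nat.mul_sub]
  rw [← h1]
  have hB := h.1
  clear h h1
  induction B using Multiset.induction_on with
  | empty => simp
  | cons b B ih =>
    simp only [Multiset.card_cons, Multiset.countP_cons, Finset.sum_add_distrib]
    rw [mul_add, ih fun b hb => hB b (by simp [hb]), Finset.sum_boole]
    congr 1
    obtain ⟨p, q, r, s, rfl, hn⟩ := (hB b (by simp)).exists_four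
    have : (Finset.univ : Finset α).offDiag.filter (fun x => [x.1, x.2].Sublist [p, q, r, s]) =
        {(p, q), (p, r), (p, s), (q, r), (q, s), (r, s)} := by
      ext ⟨x, y⟩
      simp only [Finset.mem_filter, Finset.mem_offDiag, Finset.mem_univ, true_and,
        pair_sublist_four, Finset.mem_insert, Finset.mem_singleton, Prod.mk.injEq]
      grind
    rw [this]
    obtain ⟨h1, h2, h3, h4, h5, h6⟩ := hn
    rw [Finset.card_insert_of_notMem, Finset.card_insert_of_notMem, Finset.card_insert_of_notMem,
      Finset.card_insert_of_notMem, Finset.card_insert_of_notMem, Finset.card_singleton] <;>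
      simp [*, Ne.symm]

/-- Two lists are swappable if some ordered pair is consecutive in one of them and its reverse is
consecutive in the other. -/
def Swappable {α : Type*} (b b' : List α) : Prop :=
  ∃ l r l' r' : List α, ∃ x y : α, b = l ++ [x, y] ++ r ∧ b' = l' ++ [y, x] ++ r'

theorem Swappable.map {α β : Type*} {b b' : List α} (h : Swappable b b') (f : α → β) :
    Swappable (b.map f) (b'.map f) := by
  obtain ⟨l, r, l', r', x, y, rfl, rfl⟩ := h
  exact ⟨l.map f, r.map f, l'.map f, r'.map f, f x, f y, by simp, by simp⟩

/-- `B` contains `k` disjoint triples of pairwise swappable blocks. -/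
def HasTriples {α : Type*} (B : Multiset (List α)) (k : ℕ) : Prop :=
  ∃ M : Multiset (Multiset (List α)), Multiset.card M = k ∧ M.join ≤ B ∧
    ∀ T ∈ M, ∃ b₁ b₂ b₃, T = {b₁, b₂, b₃} ∧
      Swappable b₁ b₂ ∧ Swappable b₁ b₃ ∧ Swappable b₂ b₃

namespace HasTriples

variable {α β : Type*} {B B' : Multiset (List α)} {k k' : ℕ}

theorem zero (B : Multiset (List α)) : HasTriples B 0 := ⟨0, by simp, by simp, by simp⟩

theorem add (h : HasTriples B k) (h' : HasTriples B' k') : HasTriples (B + B') (k + k') := by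
  obtain ⟨M, rfl, hM, hT⟩ := h
  obtain ⟨M', rfl, hM', hT'⟩ := h'
  refine ⟨M + M', by simp, by rw [Multiset.join_add]; exact add_le_add hM hM', fun T h => ?_⟩
  rcases Multiset.mem_add.1 h with h | h
  exacts [hT T h, hT' T h]

theorem sum {ι : Type*} (s : Finset ι) (M : ι → Multiset (List α)) (k : ι → ℕ)
    (h : ∀ i ∈ s, HasTriples (M i) (k i)) : HasTriples (∑ i ∈ s, M i) (∑ i ∈ s, k i) := by
  induction s using Finset.induction_on with
  | empty => exact zero _
  | insert a s ha ih =>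
    rw [Finset.sum_insert ha, Finset.sum_insert ha]
    exact (h a (by simp)).add (ih fun i hi => h i (by simp [hi]))

theorem map (h : HasTriples B k) (f : α → β) : HasTriples (B.map (List.map f)) k := by
  obtain ⟨M, rfl, hM, hT⟩ := h
  refine ⟨M.map (Multiset.map (List.map f)), by simp, ?_, fun T h => ?_⟩
  · rw [← Multiset.map_join]
    exact Multiset.map_le_map hM
  · obtain ⟨T, hTM, rfl⟩ := Multiset.mem_map.1 h
    obtain ⟨b₁, b₂, b₃, rfl, h₁, h₂, h₃⟩ := hT T hTM
    exact ⟨_, _, _, by simp, h₁.map f, h₂.map f, h₃.map f⟩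

end HasTriples

theorem IsDD.nodup {α : Type*} {B : Multiset (List α)} (h : IsDD 2 4 1 B) : B.Nodup := by
  rw [Multiset.nodup_iff_count_le_one]
  intro b
  by_cases hb : b ∈ B
  · obtain ⟨p, q, r, s, rfl, hn⟩ := (h.1 b hb).exists_four
    have := h.2 [p, q] (by simpa using hn.1) rfl
    rw [← this, Multiset.count]
    rw [Multiset.countP_eq_card_filter, Multiset.countP_eq_card_filter]
    refine Multiset.card_le_card (Multiset.monotone_filter_right _ ?_)
    rintro b rfl
    simp
  · simp [Multiset.count_eq_zero_of_notMem hb]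

theorem pair_sublist_swap {α : Type*} {l r : List α} {x y p q : α} (h : ¬ (p = x ∧ q = y))
    (h' : ¬ (p = y ∧ q = x)) :
    [p, q].Sublist (l ++ [x, y] ++ r) ↔ [p, q].Sublist (l ++ [y, x] ++ r) := by
  have aux : ∀ a b : α, [p, q].Sublist [a, b] ↔ p = a ∧ q = b := by
    intro a b
    simp only [List.cons_sublist_cons', List.sublist_nil]
    simp
  simp only [pair_sublist_append, aux, List.mem_append, List.mem_cons, List.not_mem_nil, or_false]
  tauto

theorem pair_sublist_of_swap {α : Type*} {l r : List α} {x y : α} :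
    [x, y].Sublist (l ++ [x, y] ++ r) := by
  simp

theorem not_pair_sublist_of_nodup {α : Type*} {b : List α} (hb : b.Nodup) {x y : α}
    (h : [x, y].Sublist b) : ¬ [y, x].Sublist b := by
  intro h'
  induction b with
  | nil => simp at h
  | cons a b ih =>
    simp only [List.cons_sublist_cons', List.singleton_sublist] at h h'
    have hs : ∀ u v : α, [u, v].Sublist b → u ∈ b ∧ v ∈ b := fun u v h =>
      ⟨h.subset (by simp), h.subset (by simp)⟩
    have := hs x y
    have := hs y x
    grind

theorem IsDefiningSet.mem_or_mem {α : Type*} {B S : Multiset (List α)} (hB : IsDD 2 4 1 B)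
    (hS : IsDefiningSet 2 4 1 B S) {b b' : List α} (hb : b ∈ B) (hb' : b' ∈ B)
    (h : Swappable b b') : b ∈ S ∨ b' ∈ S := by
  by_contra! hn
  obtain ⟨l, r, l', r', x, y, rfl, rfl⟩ := h
  have hbn := (hB.1 _ hb).1
  have hbn' := (hB.1 _ hb').1
  have hxy : x ≠ y := by
    have : [x, y].Nodup := pair_sublist_of_swap.nodup hbn
    simpa using this
  have hyx : ¬ [y, x].Sublist (l ++ [x, y] ++ r) :=
    not_pair_sublist_of_nodup hbn pair_sublist_of_swap
  have hxy' : ¬ [x, y].Sublist (l' ++ [y, x] ++ r') :=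
    not_pair_sublist_of_nodup hbn' pair_sublist_of_swap
  have perm : ∀ (l r : List α) (x y : α), (l ++ [y, x] ++ r).Perm (l ++ [x, y] ++ r) :=
    fun l r x y => ((List.Perm.swap x y []).append_left l).append_right r
  have hcn := (perm l r x y).nodup_iff.2 hbn
  have hcn' := (perm l' r' y x).nodup_iff.2 hbn'
  have hcyx : ¬ [x, y].Sublist (l ++ [y, x] ++ r) :=
    not_pair_sublist_of_nodup hcn pair_sublist_of_swap
  have hcxy' : ¬ [y, x].Sublist (l' ++ [x, y] ++ r') :=
    not_pair_sublist_of_nodup hcn' pair_sublist_of_swap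
  obtain ⟨R₀, rfl⟩ := Multiset.exists_cons_of_mem hb
  have hbb : l' ++ [y, x] ++ r' ≠ l ++ [x, y] ++ r := fun e => hxy' (e ▸ pair_sublist_of_swap)
  obtain ⟨R, rfl⟩ := Multiset.exists_cons_of_mem ((Multiset.mem_cons.1 hb').resolve_left hbb)
  have hSR : S ≤ R := by
    have h1 := (Multiset.le_cons_of_notMem hn.1).1 hS.1
    exact (Multiset.le_cons_of_notMem hn.2).1 h1
  have hDD : IsDD 2 4 1 ((l ++ [y, x] ++ r) ::ₘ (l' ++ [x, y] ++ r') ::ₘ R) := by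
    refine ⟨fun c hc => ?_, fun s hs hl => ?_⟩
    · rcases Multiset.mem_cons.1 hc with rfl | hc
      · exact ⟨hcn, (perm l r x y).length_eq.trans (hB.1 _ hb).2⟩
      rcases Multiset.mem_cons.1 hc with rfl | hc
      · exact ⟨hcn', (perm l' r' y x).length_eq.trans (hB.1 _ hb').2⟩
      · exact hB.1 c (by simp [hc])
    · obtain ⟨p, q, rfl⟩ := List.length_eq_two.1 hl
      rw [← hB.2 _ hs rfl]
      simp only [Multiset.countP_cons]
      by_cases h1 : p = x ∧ q = y
      · obtain ⟨rfl, rfl⟩ := h1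
        rw [if_pos pair_sublist_of_swap, if_pos pair_sublist_of_swap, if_neg hxy', if_neg hcyx]
      by_cases h2 : p = y ∧ q = x
      · obtain ⟨rfl, rfl⟩ := h2
        rw [if_pos pair_sublist_of_swap, if_pos pair_sublist_of_swap, if_neg hyx, if_neg hcxy']
      · simp only [pair_sublist_swap h1 h2]
  have heq := hS.2 _ hDD (hSR.trans ((Multiset.le_cons_self _ _).trans (Multiset.le_cons_self _ _)))
  have hmem : l ++ [y, x] ++ r ∈
      (l ++ [x, y] ++ r) ::ₘ (l' ++ [y, x] ++ r') ::ₘ R := heq ▸ Multiset.mem_cons_self _ _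
  have hR : l ++ [y, x] ++ r ∉ R := by
    intro hR
    have h1 := hB.2 [y, x] (by simpa using hxy.symm) rfl
    rw [Multiset.countP_cons, Multiset.countP_cons, if_neg hyx, if_pos pair_sublist_of_swap] at h1
    have h2 : R.countP (fun b => [y, x].Sublist b) = 0 := by omega
    exact Multiset.countP_eq_zero.1 h2 _ hR pair_sublist_of_swap
  rw [Multiset.mem_cons, Multiset.mem_cons] at hmem
  rcases hmem with h1 | h1 | h1
  · exact hyx (h1 ▸ pair_sublist_of_swap)
  · obtain ⟨p, q, hpq⟩ : ∃ p q, l ++ r = [p, q] := by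
      refine List.length_eq_two.1 ?_
      have := (hB.1 _ hb).2
      simp at this ⊢
      omega
    have hsub : ∀ x y : α, [p, q].Sublist (l ++ [x, y] ++ r) := by
      intro x y
      rw [← hpq]
      exact (List.sublist_append_left l [x, y]).append (List.Sublist.refl r)
    have hs1 := hsub x y
    have hs2 := hsub y x
    rw [h1] at hs2
    have hpq' := hB.2 [p, q] (hs1.nodup hbn) rfl
    rw [Multiset.countP_cons, Multiset.countP_cons, if_pos hs1, if_pos hs2] at hpq'
    omega
  · exact hR h1

theorem IsDefiningSet.two_mul_le_card {α : Type*} {B S : Multiset (List α)} (hB : IsDD 2 4 1 B)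
    (hS : IsDefiningSet 2 4 1 B S) {k : ℕ} (h : HasTriples B k) : 2 * k ≤ Multiset.card S := by
  obtain ⟨M, rfl, hM, hT⟩ := h
  have h1 : ∀ N ≤ M, 2 * Multiset.card N ≤ Multiset.countP (· ∈ S) N.join := by
    intro N
    induction N using Multiset.induction_on with
    | empty => simp
    | cons T N ih =>
      intro hN
      have h2 := ih ((Multiset.le_cons_self _ _).trans hN)
      have hTM : T ∈ M := Multiset.mem_of_le hN (by simp)
      have hmem : ∀ b ∈ T, b ∈ B := fun b hb =>
        Multiset.mem_of_le hM (Multiset.mem_join.2 ⟨T, hTM, hb⟩)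
      obtain ⟨b₁, b₂, b₃, rfl, h₁₂, h₁₃, h₂₃⟩ := hT T hTM
      have m₁ := hmem b₁ (by simp)
      have m₂ := hmem b₂ (by simp)
      have m₃ := hmem b₃ (by simp)
      have h₁₂ := hS.mem_or_mem hB m₁ m₂ h₁₂
      have h₁₃ := hS.mem_or_mem hB m₁ m₃ h₁₃
      have h₂₃ := hS.mem_or_mem hB m₂ m₃ h₂₃
      rw [Multiset.join_cons, Multiset.countP_add, Multiset.card_cons]
      have : 2 ≤ Multiset.countP (· ∈ S) {b₁, b₂, b₃} := by
        simp only [Multiset.insert_eq_cons, ← Multiset.cons_zero, Multiset.countP_cons,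
          Multiset.countP_zero]
        by_cases b₁ ∈ S <;> by_cases b₂ ∈ S <;> by_cases b₃ ∈ S <;> simp_all
      omega
  refine (h1 M le_rfl).trans ?_
  rw [Multiset.countP_eq_card_filter]
  refine Multiset.card_le_card ((Multiset.le_iff_subset ?_).2 fun b hb => ?_)
  · exact (Multiset.nodup_of_le hM hB.nodup).filter _
  · exact (Multiset.mem_filter.1 hb).2

/-- The ordered pairs appearing in a block of size four. -/
def pairList : List ℕ → List (ℕ × ℕ)
  | [a, b, c, d] => [(a, b), (a, c), (a, d), (b, c), (b, d), (c, d)]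
  | _ => []

/-- A check that the elements of a list are distinct and not among the bits of `m`. -/
def distinctCheck : ℕ → List ℕ → Bool
  | _, [] => true
  | 0, c :: l => distinctCheck (1 <<< c) l
  | m + 1, c :: l => bif (m + 1).testBit c then false else distinctCheck ((m + 1) ||| 1 <<< c) l

/-- A check that `L` consists of lists of length four, and that the pairs appearing in them are
distinct pairs of distinct numbers below `v` satisfying `q`. -/
def coverCheck (v : ℕ) (q : ℕ → ℕ → Bool) (L : List (List ℕ)) : Bool :=
  L.all (fun b => Nat.beq b.length 4) &&
    ((L.flatMap pairList).all (fun p =>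
      Nat.blt p.1 v && Nat.blt p.2 v && !(Nat.beq p.1 p.2) && q p.1 p.2) &&
    distinctCheck 0 ((L.flatMap pairList).map fun p => p.1 * v + p.2))

theorem distinctCheck_cons {m c : ℕ} {l : List ℕ} :
    distinctCheck m (c :: l) = (!m.testBit c && distinctCheck (m ||| 1 <<< c) l) := by
  cases m with
  | zero => simp [distinctCheck]
  | succ m => rw [distinctCheck]; cases (m + 1).testBit c <;> simp

theorem nodup_of_distinctCheck {m : ℕ} {l : List ℕ} (h : distinctCheck m l = true) :
    l.Nodup ∧ ∀ i ∈ l, m.testBit i = false := by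
  induction l generalizing m with
  | nil => simp
  | cons c l ih =>
    rw [distinctCheck_cons, Bool.and_eq_true, Bool.not_eq_true'] at h
    obtain ⟨h1, h2⟩ := ih h.2
    have h3 : ∀ i ∈ l, m.testBit i = false ∧ i ≠ c := by
      intro i hi
      have := h2 i hi
      rw [Nat.testBit_or, Nat.one_shiftLeft, Nat.testBit_two_pow, Bool.or_eq_false_iff] at this
      exact ⟨this.1, fun e => by simp [e] at this⟩
    refine ⟨List.nodup_cons.2 ⟨fun hc => (h3 c hc).2 rfl, h1⟩, fun i hi => ?_⟩
    rcases List.mem_cons.1 hi with rfl | hi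
    exacts [h.1, (h3 i hi).1]

theorem covers_of_coverCheck {v : ℕ} {q : ℕ → ℕ → Bool} {L : List (List ℕ)}
    (h : coverCheck v q L = true)
    (hL : ((Finset.range v).offDiag.filter fun p => q p.1 p.2 = true).card = 6 * L.length) :
    Covers (L : Multiset (List ℕ)) (fun x y => (x < v ∧ y < v) ∧ q x y = true) := by
  simp only [coverCheck, Bool.and_eq_true, List.all_eq_true, Nat.blt_eq,
    Bool.not_eq_true'] at h
  obtain ⟨h4, hP, hd⟩ := h
  have hne : ∀ p ∈ L.flatMap pairList, p.1 ≠ p.2 := fun p hp e => by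
    have := (hP p hp).1.2
    simp [e] at this
  have hnodup : (L.flatMap pairList).Nodup := (nodup_of_distinctCheck hd).1.of_map
  have hblock : ∀ b ∈ L, ∃ p q r s, b = [p, q, r, s] ∧ b.Nodup := by
    intro b hb
    have hl := h4 b hb
    obtain ⟨p, q, r, s, rfl⟩ : ∃ p q r s, b = [p, q, r, s] := by
      match b, hl with
      | [p, q, r, s], _ => exact ⟨p, q, r, s, rfl⟩
    refine ⟨p, q, r, s, rfl, ?_⟩
    have hne' : ∀ x ∈ pairList [p, q, r, s], x.1 ≠ x.2 := fun x hx =>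
      hne x (List.mem_flatMap.2 ⟨_, hb, hx⟩)
    simp [pairList] at hne'
    simp
    tauto
  have hlen : (L.flatMap pairList).length = 6 * L.length := by
    have : ∀ b ∈ L, (pairList b).length = 6 := by
      intro b hb
      obtain ⟨p, q, r, s, rfl, -⟩ := hblock b hb
      rfl
    rw [List.length_flatMap, List.map_congr_left this]
    simp [mul_comm]
  have hmem : ∀ x y, x ≠ y → ((x, y) ∈ L.flatMap pairList ↔ (x < v ∧ y < v) ∧ q x y = true) := by
    have hs : (L.flatMap pairList).toFinset ⊆
        (Finset.range v).offDiag.filter fun p => q p.1 p.2 = true := by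
      intro p hp
      rw [List.mem_toFinset] at hp
      simp only [Finset.mem_filter, Finset.mem_offDiag, Finset.mem_range]
      have := hP p hp
      exact ⟨⟨this.1.1.1, this.1.1.2, hne p hp⟩, this.2⟩
    have he := Finset.eq_of_subset_of_card_le hs
      (by rw [List.toFinset_card_of_nodup hnodup, hlen, hL])
    intro x y hxy
    rw [← List.mem_toFinset, he]
    simp [hxy]
  refine ⟨fun b hb => ?_, fun x y hxy => ?_⟩
  · obtain ⟨p, q, r, s, rfl, hn⟩ := hblock b hb
    exact ⟨hn, rfl⟩
  · have hc : ∀ b ∈ L, (pairList b).count (x, y) = if [x, y].Sublist b then 1 else 0 := by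
      intro b hb
      obtain ⟨p, q, r, s, rfl, hn⟩ := hblock b hb
      simp only [pair_sublist_four]
      simp only [pairList, List.count_cons, List.count_nil, beq_iff_eq, Prod.mk.injEq]
      simp at hn
      grind
    have : (L : Multiset (List ℕ)).countP (fun b => [x, y].Sublist b) =
        (L.flatMap pairList).count (x, y) := by
      clear hnodup hmem hlen hL hd hP h4 hne hblock
      induction L with
      | nil => simp
      | cons b L ih =>
        rw [List.flatMap_cons, List.count_append, hc b (by simp),
          ← ih fun b hb => hc b (by simp [hb]), ← Multiset.cons_coe, Multiset.countP_cons, add_comm]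
    refine Eq.trans (by congr!) (this.trans ?_)
    simp only [← hmem x y hxy]
    split_ifs with hxy
    · exact List.count_eq_one_of_mem hnodup hxy
    · exact List.count_eq_zero_of_not_mem hxy

/-- The translate by `s` of the point `x`, for the cyclic group of order `m` acting on copies
`[0, m), [m, 2 * m), …` of itself below `n`; the points from `n` on are fixed. -/
def cyclicTranslate (m n s x : ℕ) : ℕ :=
  bif Nat.blt x n then x / m * m + (x % m + s) % m else x

/-- All translates of the given base blocks. -/
def develop (m n : ℕ) (base : List (List ℕ)) : List (List ℕ) :=
  base.flatMap fun b => (List.range m).map fun s => b.map (cyclicTranslate m n s)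

/-- Triples `(u, m, base)` such that the translates of `base` by the cyclic group of order `m` form
a directed design on `3 * u + 1` points. -/
def smallDesigns : List (ℕ × ℕ × List (List ℕ)) :=
  [(1, 1,
    [[0, 1, 2, 3], [3, 2, 1, 0]]),
   (2, 7,
    [[0, 6, 3, 1]]),
   (3, 3,
    [[3, 9, 8, 2], [0, 7, 9, 3], [0, 6, 8, 1], [6, 3, 4, 7], [0, 5, 4, 2]]),
   (7, 7,
    [[14, 6, 1, 19], [14, 5, 2, 17], [14, 3, 4, 20], [7, 6, 2, 11], [7, 5, 4, 8], [7, 3, 1, 9],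
    [14, 13, 9, 18], [14, 12, 11, 15], [14, 10, 8, 16], [21, 0, 7, 14], [14, 7, 0, 21]]),
   (8, 25,
    [[0, 5, 12, 15], [0, 4, 22, 23], [0, 17, 6, 8], [0, 21, 9, 20]]),
   (9, 9,
    [[0, 14, 8, 25], [0, 13, 1, 20], [9, 8, 4, 2], [9, 1, 5, 7], [18, 26, 5, 15], [18, 19, 4, 12],
    [0, 16, 15, 21], [0, 11, 12, 24], [18, 24, 8, 22], [18, 21, 1, 23], [9, 26, 16, 13],
    [9, 19, 11, 14], [27, 0, 9, 18], [18, 9, 0, 27]]),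
   (10, 31,
    [[0, 21, 1, 13], [0, 29, 3, 7], [0, 22, 28, 15], [0, 30, 16, 26], [0, 25, 14, 2]]),
   (11, 11,
    [[11, 10, 4, 18], [11, 8, 1, 21], [11, 2, 3, 19], [11, 6, 9, 13], [11, 7, 5, 17],
    [22, 10, 9, 26], [22, 8, 5, 23], [22, 2, 4, 25], [22, 6, 1, 31], [22, 7, 3, 27],
    [22, 21, 15, 29], [22, 19, 12, 32], [22, 13, 14, 30], [22, 17, 20, 24], [22, 18, 16, 28],
    [33, 0, 11, 22], [22, 11, 0, 33]]),
   (12, 37,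
    [[0, 35, 23, 36], [0, 29, 12, 14], [0, 32, 21, 3], [0, 31, 11, 4], [0, 27, 34, 6],
    [0, 28, 15, 33]]),
   (13, 13,
    [[26, 25, 1, 2], [26, 23, 3, 6], [26, 17, 9, 5], [0, 37, 8, 14], [0, 33, 11, 16],
    [0, 34, 7, 22], [0, 25, 20, 6], [0, 23, 21, 5], [0, 17, 24, 2], [0, 35, 4, 36],
    [0, 27, 12, 30], [0, 29, 10, 38], [26, 19, 37, 28], [26, 18, 33, 32], [26, 15, 34, 31],
    [13, 22, 34, 19], [13, 14, 37, 18], [13, 16, 33, 15], [39, 0, 13, 26], [26, 13, 0, 39]]),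
   (14, 43,
    [[0, 24, 31, 1], [0, 41, 21, 14], [0, 26, 12, 18], [0, 37, 27, 3], [0, 34, 2, 30],
    [0, 40, 5, 22], [0, 38, 10, 42]]),
   (15, 15,
    [[30, 32, 11, 31], [0, 2, 26, 1], [15, 17, 41, 16], [30, 16, 36, 3], [0, 31, 6, 18],
    [15, 1, 21, 33], [30, 8, 2, 24], [0, 23, 17, 39], [15, 38, 32, 9], [30, 27, 41, 22],
    [0, 42, 11, 37], [15, 12, 26, 7], [30, 35, 19, 38], [0, 5, 34, 8], [15, 20, 4, 23],
    [30, 25, 13, 23], [0, 40, 28, 38], [15, 10, 43, 8], [30, 37, 28, 34], [0, 7, 43, 4],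
    [15, 22, 13, 19], [45, 0, 15, 30], [30, 15, 0, 45]]),
   (16, 49,
    [[0, 28, 2, 29], [0, 24, 38, 7], [0, 33, 37, 43], [0, 30, 42, 45], [0, 16, 47, 11],
    [0, 21, 41, 46], [0, 22, 39, 9], [0, 35, 26, 34]]),
   (17, 17,
    [[0, 31, 50, 1], [0, 22, 47, 4], [0, 20, 35, 16], [0, 29, 38, 13], [0, 48, 7, 33],
    [0, 39, 11, 30], [0, 37, 10, 18], [0, 46, 6, 21], [34, 16, 14, 39], [34, 13, 5, 37],
    [34, 1, 3, 46], [34, 4, 12, 48], [17, 15, 26, 3], [17, 9, 19, 12], [17, 2, 25, 14],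
    [17, 8, 32, 5], [17, 45, 31, 27], [17, 44, 22, 23], [17, 40, 20, 24], [17, 41, 29, 28],
    [34, 28, 50, 41], [34, 27, 47, 45], [34, 23, 35, 44], [34, 24, 38, 40], [51, 0, 17, 34],
    [34, 17, 0, 51]]),
   (18, 55,
    [[0, 54, 5, 47], [0, 45, 18, 20], [0, 49, 29, 11], [0, 41, 19, 26], [0, 53, 14, 23],
    [0, 39, 51, 52], [0, 44, 21, 4], [0, 50, 31, 3], [0, 43, 10, 34]]),
   (19, 19,
    [[19, 47, 35, 22], [19, 44, 36, 21], [19, 42, 24, 33], [0, 49, 29, 28], [0, 39, 32, 25],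
    [0, 45, 34, 23], [19, 30, 51, 12], [19, 20, 53, 8], [19, 26, 48, 18], [19, 17, 29, 45],
    [19, 5, 32, 49], [19, 16, 34, 39], [19, 9, 15, 50], [19, 6, 10, 46], [19, 4, 13, 56],
    [38, 14, 28, 11], [38, 3, 25, 1], [38, 2, 23, 7], [0, 14, 46, 30], [0, 3, 56, 20],
    [0, 2, 50, 26], [38, 17, 6, 13], [38, 5, 4, 15], [38, 16, 9, 10], [38, 56, 53, 41],
    [38, 50, 48, 40], [38, 46, 51, 52], [57, 0, 19, 38], [38, 19, 0, 57]])]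

/-- The blocks of the directed design given by an entry of `smallDesigns`. -/
def smallBlocks (p : ℕ × ℕ × List (List ℕ)) : List (List ℕ) :=
  develop p.2.1 ((3 * p.1 + 1) / p.2.1 * p.2.1) p.2.2

theorem smallDesigns_check :
    smallDesigns.all (fun p => coverCheck (3 * p.1 + 1) (fun _ _ => true) (smallBlocks p) &&
      Nat.beq ((3 * p.1 + 1) * (3 * p.1)) (6 * (smallBlocks p).length)) = true := by
  decide +kernel

/-- There is a directed design on `3 * u + 1` points containing `k` disjoint triples of pairwise
swappable blocks. -/
def ExistsDesign (u k : ℕ) : Prop :=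
  ∃ B : Multiset (List (Fin (3 * u + 1))), Covers B (fun _ _ => True) ∧ HasTriples B k

theorem existsDesign_of_mem_smallDesigns {p : ℕ × ℕ × List (List ℕ)} (hp : p ∈ smallDesigns) :
    ExistsDesign p.1 0 := by
  have h := List.all_eq_true.1 smallDesigns_check p hp
  rw [Bool.and_eq_true] at h
  have hc := covers_of_coverCheck h.1 (by
    have := Nat.eq_of_beq_eq_true h.2
    simp only [Finset.filter_true, Finset.offDiag_card, Finset.card_range, ← this]
    rw [Nat.mul_add_one, Nat.add_sub_cancel_right])
  have hf : Set.InjOn (Fin.ofNat (3 * p.1 + 1)) {x | x < 3 * p.1 + 1} := by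
    intro x hx y hy hxy
    simpa [Fin.ext_iff, Nat.mod_eq_of_lt hx, Nat.mod_eq_of_lt hy] using hxy
  refine ⟨_, (hc.map (fun x y h => h.1) hf).congr fun x y _ => ?_, HasTriples.zero _⟩
  exact iff_of_true ⟨x, y, by simp, by simp, ⟨x.is_lt, y.is_lt⟩, rfl⟩ trivial

theorem existsDesign_zero : ExistsDesign 0 0 :=
  ⟨0, ⟨by simp, fun x y hxy => absurd (Subsingleton.elim (α := Fin 1) x y) hxy⟩, HasTriples.zero _⟩

theorem existsDesign_small {u : ℕ} (hu : u ≤ 3 ∨ 7 ≤ u ∧ u ≤ 19) : ExistsDesign u 0 := by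
  rcases Nat.eq_zero_or_pos u with rfl | h0
  · exact existsDesign_zero
  · have : ∀ u < 20, 0 < u → (u ≤ 3 ∨ 7 ≤ u) → ∃ p ∈ smallDesigns, p.1 = u := by decide
    obtain ⟨p, hp, rfl⟩ := this u (by omega) h0 (by omega)
    exact existsDesign_of_mem_smallDesigns hp

/-- The group of a point of a group divisible design with `k` groups of size three. -/
def groupOf (k x : ℕ) : ℕ := bif Nat.beq k 4 then x / 3 else bif Nat.blt x 15 then x % 5 else 5

/-- The position of a point in its group. -/
def groupPos (k x : ℕ) : ℕ :=
  bif Nat.beq k 4 then x % 3 else bif Nat.blt x 15 then x / 5 else x - 15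

/-- The triples of pairwise swappable blocks partitioning a group divisible directed design with
five groups of size three. -/
def fiveTriples : List (List (List ℕ)) :=
  (List.range 5).flatMap fun s =>
    [[[10, 4, 6, 8], [2, 4, 10, 3], [6, 4, 2, 5]],
      [[13, 0, 14, 12], [5, 12, 14, 6], [8, 6, 14, 0]]].map fun T =>
        T.map fun b => b.map (cyclicTranslate 5 15 s)

/-- The blocks of a directed group divisible design with `k` groups of size three. -/
def groupBlocks (k : ℕ) : List (List ℕ) :=
  bif Nat.beq k 4 then
    develop 3 12
      [[0, 3, 6, 9], [0, 5, 10, 7], [9, 2, 3, 7], [6, 4, 0, 11], [6, 10, 5, 2], [9, 8, 5, 0]]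
  else bif Nat.beq k 5 then fiveTriples.flatten
  else
    develop 5 15
      [[10, 9, 16, 7], [10, 1, 17, 13], [10, 3, 15, 14], [0, 16, 14, 1], [5, 17, 4, 6],
       [5, 15, 9, 2], [10, 4, 12, 8], [5, 7, 13, 14], [0, 3, 6, 2]]

theorem groupBlocks_check :
    ∀ k ∈ [4, 5, 6], coverCheck (3 * k) (fun x y => !(Nat.beq (groupOf k x) (groupOf k y)))
        (groupBlocks k) = true ∧
      ((Finset.range (3 * k)).offDiag.filter fun p =>
        (!(Nat.beq (groupOf k p.1) (groupOf k p.2))) = true).card = 6 * (groupBlocks k).length := by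
  decide +kernel

theorem groupOf_check :
    ∀ k ∈ [4, 5, 6], (∀ x < 3 * k, groupOf k x < k ∧ groupPos k x < 3) ∧
      (∀ i < k, ∀ c < 3, ∃ x < 3 * k, groupOf k x = i ∧ groupPos k x = c) ∧
      ∀ x < 3 * k, ∀ y < 3 * k, groupOf k x = groupOf k y → groupPos k x = groupPos k y → x = y := by
  decide +kernel

theorem fiveTriples_check :
    ∀ T ∈ fiveTriples, ∃ b₁ ∈ T, ∃ b₂ ∈ T, ∃ b₃ ∈ T, T = [b₁, b₂, b₃] ∧
      (∃ p ∈ pairList b₁, [p.1, p.2] <:+: b₁ ∧ [p.2, p.1] <:+: b₂) ∧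
      (∃ p ∈ pairList b₁, [p.1, p.2] <:+: b₁ ∧ [p.2, p.1] <:+: b₃) ∧
      (∃ p ∈ pairList b₂, [p.1, p.2] <:+: b₂ ∧ [p.2, p.1] <:+: b₃) := by
  decide +kernel

theorem swappable_of_infix {α : Type*} {b b' : List α} {x y : α} (h : [x, y] <:+: b)
    (h' : [y, x] <:+: b') : Swappable b b' := by
  obtain ⟨l, r, rfl⟩ := h
  obtain ⟨l', r', rfl⟩ := h'
  exact ⟨l, r, l', r', x, y, rfl, rfl⟩

theorem hasTriples_fiveTriples : HasTriples (fiveTriples.flatten : Multiset (List ℕ)) 10 := by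
  refine ⟨((fiveTriples.map fun T : List (List ℕ) => (T : Multiset (List ℕ)) :
    List (Multiset (List ℕ))) : Multiset (Multiset (List ℕ))), by simp [fiveTriples], ?_, ?_⟩
  · rw [Multiset.coe_join]
  · intro T hT
    rw [Multiset.mem_coe, List.mem_map] at hT
    obtain ⟨T, hT, rfl⟩ := hT
    obtain ⟨b₁, -, b₂, -, b₃, -, rfl, ⟨p, -, h, h'⟩, ⟨p', -, k, k'⟩, ⟨p'', -, l, l'⟩⟩ :=
      fiveTriples_check T hT
    exact ⟨b₁, b₂, b₃, rfl, swappable_of_infix h h', swappable_of_infix k k',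
      swappable_of_infix l l'⟩

theorem exists_groupDivisible {ι : Type*} (S : Finset ι) (hS : S.card ∈ [4, 5, 6]) :
    ∃ B : Multiset (List (ι × Fin 3)),
      Covers B (fun x y => x.1 ≠ y.1 ∧ x.1 ∈ S ∧ y.1 ∈ S) ∧
        HasTriples B (if S.card = 5 then 10 else 0) := by
  obtain ⟨hc, hcard⟩ := groupBlocks_check _ hS
  obtain ⟨h1, h2, h3⟩ := groupOf_check _ hS
  generalize hk : S.card = k at *
  let e : Fin k ≃ S := (S.equivFinOfCardEq hk).symm
  have hk0 : 0 < k := by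
    simp at hS
    omega
  have : NeZero k := ⟨hk0.ne'⟩
  let f : ℕ → ι × Fin 3 := fun x => (e (Fin.ofNat k (groupOf k x)), Fin.ofNat 3 (groupPos k x))
  have hfst : ∀ x < 3 * k, ∀ y < 3 * k, ((f x).1 = (f y).1 ↔ groupOf k x = groupOf k y) := by
    intro x hx y hy
    simp [f, Fin.ext_iff, Nat.mod_eq_of_lt (h1 x hx).1,
      Nat.mod_eq_of_lt (h1 y hy).1]
  have hf : Set.InjOn f {x | x < 3 * k} := by
    intro x hx y hy hxy
    refine h3 x hx y hy ((hfst x hx y hy).1 (by rw [hxy])) ?_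
    have := congrArg Prod.snd hxy
    simpa [f, Fin.ext_iff, Nat.mod_eq_of_lt (h1 x hx).2, Nat.mod_eq_of_lt (h1 y hy).2] using this
  have hsurj : ∀ z : ι × Fin 3, z.1 ∈ S → ∃ x < 3 * k, f x = z := by
    rintro ⟨i, c⟩ hi
    obtain ⟨x, hx, hxi, hxc⟩ := h2 (e.symm ⟨i, hi⟩) (Fin.is_lt _) c c.is_lt
    refine ⟨x, hx, ?_⟩
    simp [f, hxi, hxc]
  refine ⟨_, ((covers_of_coverCheck hc hcard).map (fun x y h => h.1) hf).congr ?_, ?_⟩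
  · intro x y _
    constructor
    · rintro ⟨x, y, rfl, rfl, ⟨hx, hy⟩, hq⟩
      refine ⟨fun e => ?_, by simp [f], by simp [f]⟩
      simp [(hfst x hx y hy).1 e] at hq
    · rintro ⟨hne, hx, hy⟩
      obtain ⟨x, hx', rfl⟩ := hsurj x hx
      obtain ⟨y, hy', rfl⟩ := hsurj y hy
      refine ⟨x, y, rfl, rfl, ⟨hx', hy'⟩, ?_⟩
      rw [Bool.not_eq_true', ← Bool.not_eq_true, Nat.beq_eq]
      exact fun e => hne ((hfst x hx' y hy').2 e)
  · apply HasTriples.map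
    split_ifs with h5
    · subst h5
      exact hasTriples_fiveTriples
    · exact HasTriples.zero _

theorem ExistsDesign.exists_covers {u k : ℕ} (h : ExistsDesign u k) {α : Type*} (W : Finset α)
    (hW : W.card = 3 * u + 1) :
    ∃ B : Multiset (List α), Covers B (fun x y => x ∈ W ∧ y ∈ W) ∧ HasTriples B k := by
  obtain ⟨B, hB, hk⟩ := h
  let e : Fin (3 * u + 1) ≃ W := (W.equivFinOfCardEq hW).symm
  refine ⟨_, (hB.map_injective (f := fun i => (e i : α))
    (Subtype.val_injective.comp e.injective)).congr fun x y _ => ⟨?_, ?_⟩, hk.map _⟩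
  · rintro ⟨i, j, rfl, rfl, -⟩
    exact ⟨(e i).2, (e j).2⟩
  · rintro ⟨hx, hy⟩
    exact ⟨e.symm ⟨x, hx⟩, e.symm ⟨y, hy⟩, by simp, by simp, trivial⟩

theorem Covers.existsDesign {α : Type*} {W : Finset α} {B : Multiset (List α)} {u k : ℕ}
    (hB : Covers B fun x y => x ∈ W ∧ y ∈ W) (hk : HasTriples B k) (hW : W.card = 3 * u + 1) :
    ExistsDesign u k := by
  let e : W ≃ Fin (3 * u + 1) := W.equivFinOfCardEq hW
  let f : α → Fin (3 * u + 1) := fun x => if hx : x ∈ W then e ⟨x, hx⟩ else 0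
  have hfe : ∀ x (hx : x ∈ W), f x = e ⟨x, hx⟩ := fun x hx => dif_pos hx
  have hf : Set.InjOn f W := by
    intro x hx y hy hxy
    rw [hfe x hx, hfe y hy] at hxy
    simpa using hxy
  refine ⟨_, (hB.map (V := W) (fun x y h => h) hf).congr fun x y _ => iff_of_true ?_ trivial,
    hk.map f⟩
  exact ⟨e.symm x, e.symm y, by simp [hfe], by simp [hfe], by simp, by simp⟩

/-- A transversal design with the groups indexed by `ι`, the points of the group `i` being restricted to `T i`,
each point being given weight three. -/
theorem existsDesign_of_orthogonalArray {ι R L : Type*} [Fintype ι] [Nonempty ι]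
    [Fintype L] (h : ι → L → R)
    (hh : ∀ i j, i ≠ j → ∀ x y, ∃! l, h i l = x ∧ h j l = y) (T : ι → Finset R)
    (hT : ∀ l, (Finset.univ.filter fun i => h i l ∈ T i).card ∈ [4, 5, 6]) (k : ι → ℕ)
    (hk : ∀ i, ExistsDesign (T i).card (k i)) :
    ExistsDesign (∑ i, (T i).card)
      (10 * (Finset.univ.filter fun l =>
        (Finset.univ.filter fun i => h i l ∈ T i).card = 5).card + ∑ i, k i) := by
  let W : ι → Finset (Option ((ι × R) × Fin 3)) := fun i =>
    Finset.insertNone (({i} ×ˢ T i) ×ˢ Finset.univ)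
  have hW : ∀ i, (W i).card = 3 * (T i).card + 1 := by
    intro i
    simp [W, Finset.card_insertNone, mul_comm]
  choose E hE hkE using fun i => (hk i).exists_covers (W i) (hW i)
  choose D hD hkD using fun l => exists_groupDivisible _ (hT l)
  let g : L → ι × Fin 3 → Option ((ι × R) × Fin 3) := fun l x => some ((x.1, h x.1 l), x.2)
  have hg : ∀ l, Function.Injective (g l) := by
    rintro l ⟨i, c⟩ ⟨j, d⟩ hij
    simp [g] at hij ⊢
    tauto
  have hlines := Covers.sum Finset.univ (fun l => (D l).map (List.map (g l)))
    (fun l x y => ∃ p q : (ι × R) × Fin 3, x = some p ∧ y = some q ∧ p.1.1 ≠ q.1.1 ∧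
      p.1.2 ∈ T p.1.1 ∧ q.1.2 ∈ T q.1.1 ∧ h p.1.1 l = p.1.2 ∧ h q.1.1 l = q.1.2)
    (fun l _ => ((hD l).map_injective (hg l)).congr (by
      intro x y _
      constructor
      · rintro ⟨x, y, rfl, rfl, hne, hx, hy⟩
        exact ⟨_, _, rfl, rfl, hne, by simpa using hx, by simpa using hy, rfl, rfl⟩
      · rintro ⟨⟨⟨i, a⟩, c⟩, ⟨⟨j, b⟩, d⟩, rfl, rfl, hne, hp, hq, h1, h2⟩
        dsimp only at h1 h2
        subst h1 h2
        exact ⟨(i, c), (j, d), rfl, rfl, hne, by simpa using hp, by simpa using hq⟩))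
    (by
      rintro x y - l - l' - ⟨p, q, rfl, rfl, hne, -, -, h1, h2⟩ ⟨p', q', hp, hq, -, -, -, h3, h4⟩
      cases hp
      cases hq
      exact (hh _ _ hne _ _).unique ⟨h1, h2⟩ ⟨h3, h4⟩)
  have hgroups := Covers.sum Finset.univ E (fun i x y => x ∈ W i ∧ y ∈ W i) (fun i _ => hE i) (by
    rintro (_ | ⟨⟨a, r⟩, c⟩) (_ | ⟨⟨b, s⟩, d⟩) hxy i - j - <;> simp [W] at hxy ⊢ <;> grind)
  let V : Finset (Option ((ι × R) × Fin 3)) := Finset.insertNone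
    (((Finset.univ.sigma T).map (Equiv.sigmaEquivProd _ _).toEmbedding) ×ˢ Finset.univ)
  have hV : V.card = 3 * ∑ i, (T i).card + 1 := by
    simp [V, Finset.card_insertNone, mul_comm]
  have hmemV : ∀ i r c, some ((i, r), c) ∈ V ↔ r ∈ T i := by
    simp [V]
  have hmemW : ∀ i j r c, some ((j, r), c) ∈ W i ↔ j = i ∧ r ∈ T i := by
    simp [W, and_comm, eq_comm]
  have hnoneV : none ∈ V := by simp [V]
  have hnoneW : ∀ i, none ∈ W i := by simp [W]
  have htriples := (HasTriples.sum _ _ _ fun l (_ : l ∈ Finset.univ) => (hkD l).map (g l)).add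
    (HasTriples.sum _ _ _ fun i (_ : i ∈ Finset.univ) => hkE i)
  rw [← Finset.sum_filter, Finset.sum_const, smul_eq_mul, mul_comm _ 10] at htriples
  refine ((hlines.add hgroups ?_).congr ?_).existsDesign htriples hV
  · rintro x y - ⟨l, -, p, q, rfl, rfl, hne, -⟩ ⟨i, -, hp, hq⟩
    exact hne (((hmemW _ _ _ _).1 hp).1.trans ((hmemW _ _ _ _).1 hq).1.symm)
  · rintro x y -
    constructor
    · rintro (⟨l, -, p, q, rfl, rfl, -, hp, hq, -⟩ | ⟨i, -, hx, hy⟩)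
      · exact ⟨(hmemV _ _ _).2 hp, (hmemV _ _ _).2 hq⟩
      · have key : ∀ x ∈ W i, x ∈ V := by
          rintro (_ | ⟨⟨j, r⟩, c⟩) hx
          · exact hnoneV
          · obtain ⟨rfl, hr⟩ := (hmemW _ _ _ _).1 hx
            exact (hmemV _ _ _).2 hr
        exact ⟨key x hx, key y hy⟩
    · rcases x with _ | ⟨⟨i, r⟩, c⟩ <;> rcases y with _ | ⟨⟨j, s⟩, d⟩ <;> rintro ⟨hx, hy⟩
      · exact Or.inr ⟨Classical.arbitrary ι, Finset.mem_univ _, hnoneW _, hnoneW _⟩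
      · exact Or.inr ⟨j, Finset.mem_univ _, hnoneW j, (hmemW _ _ _ _).2 ⟨rfl, (hmemV _ _ _).1 hy⟩⟩
      · exact Or.inr ⟨i, Finset.mem_univ _, (hmemW _ _ _ _).2 ⟨rfl, (hmemV _ _ _).1 hx⟩, hnoneW i⟩
      · rw [hmemV] at hx hy
        by_cases hij : i = j
        · subst hij
          exact Or.inr ⟨i, Finset.mem_univ _, (hmemW _ _ _ _).2 ⟨rfl, hx⟩,
            (hmemW _ _ _ _).2 ⟨rfl, hy⟩⟩
        · obtain ⟨l, ⟨h1, h2⟩, -⟩ := hh i j hij r s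
          exact Or.inl ⟨l, Finset.mem_univ _, _, _, rfl, rfl, hij, hx, hy, h1, h2⟩

/-- The parallel classes with slopes `a i`, together with the vertical one, form an orthogonal
array. -/
def slopeArray {R κ : Type*} [CommRing R] (a : κ → R) : Option κ → R × R → R
  | none, l => l.2
  | some i, l => l.1 + a i * l.2

theorem existsUnique_slopeArray {R κ : Type*} [CommRing R] {a : κ → R}
    (ha : ∀ i j, i ≠ j → IsUnit (a i - a j)) (i j : Option κ) (hij : i ≠ j) (x y : R) :
    ∃! l, slopeArray a i l = x ∧ slopeArray a j l = y := by
  rcases i with _ | i <;> rcases j with _ | j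
  · exact absurd rfl hij
  · refine ⟨(y - a j * x, x), by simp [slopeArray], ?_⟩
    rintro ⟨b, m⟩ ⟨rfl, rfl⟩
    simp [slopeArray]
  · refine ⟨(x - a i * y, y), by simp [slopeArray], ?_⟩
    rintro ⟨b, m⟩ ⟨rfl, rfl⟩
    simp [slopeArray]
  · obtain ⟨u, hu⟩ := (ha i j (by simpa using hij)).exists_right_inv
    refine ⟨(x - a i * (u * (x - y)), u * (x - y)), ⟨by simp [slopeArray], ?_⟩, ?_⟩
    · simp only [slopeArray]
      linear_combination (y - x) * hu
    · rintro ⟨b, m⟩ ⟨rfl, rfl⟩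
      simp only [slopeArray, Prod.mk.injEq]
      constructor
      · linear_combination (a i * m) * hu
      · linear_combination (-m) * hu

theorem ExistsDesign.zero {u k : ℕ} (h : ExistsDesign u k) : ExistsDesign u 0 :=
  h.imp fun B hB => ⟨hB.1, HasTriples.zero B⟩

section Transversal

variable {R : Type*} [CommRing R] [Fintype R] {a : Fin 5 → R}

theorem ExistsDesign.four_mul_add (ha : ∀ i j, i ≠ j → IsUnit (a i - a j)) {t : ℕ}
    (ht : t ≤ Fintype.card R) (hR : ExistsDesign (Fintype.card R) 0) (h : ExistsDesign t 0) :
    ExistsDesign (4 * Fintype.card R + t) 0 := by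
  obtain ⟨T, -, hT⟩ := Finset.exists_subset_card_eq (s := (Finset.univ : Finset R)) (n := t) ht
  have := existsDesign_of_orthogonalArray (slopeArray a) (existsUnique_slopeArray ha)
    (fun i => i.elim T fun i => if i = 4 then ∅ else Finset.univ)
    (by
      intro l
      rw [Finset.card_filter, Fintype.sum_option, Fin.sum_univ_five]
      by_cases slopeArray a none l ∈ T <;> simp [*])
    (fun _ => 0)
    (by
      rintro (_ | i)
      · simpa [hT] using h
      · by_cases hi : i = 4
        · simpa [hi] using existsDesign_zero
        · simpa [hi] using hR)
  convert this.zero using 1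
  rw [Fintype.sum_option, Fin.sum_univ_five]
  simp [hT]
  ring

theorem ExistsDesign.five_mul_add (ha : ∀ i j, i ≠ j → IsUnit (a i - a j)) {t k : ℕ}
    (ht : t ≤ Fintype.card R) (hR : ExistsDesign (Fintype.card R) k) (h : ExistsDesign t 0) :
    ExistsDesign (5 * Fintype.card R + t)
      (10 * (Fintype.card R * (Fintype.card R - t)) + 5 * k) := by
  obtain ⟨T, -, hT⟩ := Finset.exists_subset_card_eq (s := (Finset.univ : Finset R)) (n := t) ht
  have hcard : ∀ l, (Finset.univ.filter fun i : Option (Fin 5) =>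
      slopeArray a i l ∈ i.elim T fun _ => Finset.univ).card = if l.2 ∈ T then 6 else 5 := by
    intro l
    rw [Finset.card_filter, Fintype.sum_option, Fin.sum_univ_five]
    by_cases l.2 ∈ T <;> simp [slopeArray, *]
  have := existsDesign_of_orthogonalArray (slopeArray a) (existsUnique_slopeArray ha)
    (fun i => i.elim T fun _ => Finset.univ)
    (by
      intro l
      rw [hcard]
      split_ifs <;> simp)
    (fun i => i.elim 0 fun _ => k)
    (by
      rintro (_ | i)
      · simpa [hT] using h
      · simpa using hR)
  simp only [hcard] at this
  convert this using 1
  · rw [Fintype.sum_option, Fin.sum_univ_five]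
    simp [hT]
    ring
  · have hs : (Finset.univ.filter fun l : R × R => (if l.2 ∈ T then 6 else 5) = 5) =
        Finset.univ ×ˢ Tᶜ := by
      ext l
      by_cases l.2 ∈ T <;> simp [*]
    rw [Fintype.sum_option, Fin.sum_univ_five, hs, Finset.card_product, Finset.card_compl, hT]
    simp
    ring

end Transversal

theorem isUnit_zmod_sub {n : ℕ} (hn : Nat.Coprime n 6) (i j : Fin 5) (hij : i ≠ j) :
    IsUnit (((i : ℕ) : ZMod n) - ((j : ℕ) : ZMod n)) := by
  have h2 : Nat.Coprime 2 n := (hn.coprime_dvd_right (by norm_num)).symm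
  have h3 : Nat.Coprime 3 n := (hn.coprime_dvd_right (by norm_num)).symm
  have key : ∀ k : ℕ, 0 < k → k < 5 → IsUnit (k : ZMod n) := by
    intro k h0 h5
    rw [ZMod.isUnit_iff_coprime]
    interval_cases k
    · simp
    · exact h2
    · exact h3
    · exact Nat.Coprime.pow_left 2 h2
  wlog h : j < i generalizing i j
  · rw [← neg_sub]
    exact (this j i hij.symm (lt_of_le_of_ne (not_lt.1 h) hij)).neg
  · rw [← Nat.cast_sub (by omega)]
    exact key _ (by omega) (by omega)

theorem ExistsDesign.four_mul_add_of_coprime {n t : ℕ} (hn : Nat.Coprime n 6) (ht : t ≤ n)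
    (h : ExistsDesign n 0) (h' : ExistsDesign t 0) : ExistsDesign (4 * n + t) 0 := by
  have : NeZero n := ⟨by rintro rfl; simp at hn⟩
  simpa using ExistsDesign.four_mul_add (isUnit_zmod_sub hn) (by simpa using ht)
    (by simpa using h) h'

theorem ExistsDesign.five_mul_add_of_coprime {n t k : ℕ} (hn : Nat.Coprime n 6) (ht : t ≤ n)
    (h : ExistsDesign n k) (h' : ExistsDesign t 0) :
    ExistsDesign (5 * n + t) (10 * (n * (n - t)) + 5 * k) := by
  have : NeZero n := ⟨by rintro rfl; simp at hn⟩
  simpa using ExistsDesign.five_mul_add (isUnit_zmod_sub hn) (by simpa using ht)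
    (by simpa using h) h'

theorem existsDesign_forty_three : ExistsDesign 43 0 := by
  let := Fintype.ofFinite (GaloisField 3 2)
  have hF : Fintype.card (GaloisField 3 2) = 9 := by
    rw [← Nat.card_eq_fintype_card, GaloisField.card 3 2 (by norm_num)]
    norm_num
  obtain ⟨a⟩ : Nonempty (Fin 5 ↪ GaloisField 3 2) :=
    Function.Embedding.nonempty_of_card_le (by simp [hF])
  have := ExistsDesign.four_mul_add (a := a) (t := 7)
    (fun i j hij => (sub_ne_zero.2 (a.injective.ne hij)).isUnit) (by simp [hF])
    (hF ▸ existsDesign_small (by norm_num)) (existsDesign_small (by norm_num))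
  rwa [hF] at this

theorem existsDesign_zero_triples (u : ℕ) : ExistsDesign u 0 := by
  induction u using Nat.strong_induction_on with
  | _ u ih =>
    have four : ∀ n : ℕ, n.Coprime 6 → 0 < n → 4 * n ≤ u → u ≤ 5 * n → ExistsDesign u 0 := by
      intro n hn h0 h1 h2
      have := ExistsDesign.four_mul_add_of_coprime (t := u - 4 * n) hn (by omega)
        (ih n (by omega)) (ih _ (by omega))
      rwa [show 4 * n + (u - 4 * n) = u by omega] at this
    have five : ∀ n : ℕ, n.Coprime 6 → 0 < n → 5 * n ≤ u → u ≤ 6 * n → ExistsDesign u 0 := by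
      intro n hn h0 h1 h2
      have := (ExistsDesign.five_mul_add_of_coprime (t := u - 5 * n) hn (by omega)
        (ih n (by omega)) (ih _ (by omega))).zero
      rwa [show 5 * n + (u - 5 * n) = u by omega] at this
    rcases lt_or_ge u 100 with hu | hu
    · by_cases h1 : u ≤ 3 ∨ 7 ≤ u ∧ u ≤ 19
      · exact existsDesign_small h1
      rcases eq_or_ne u 43 with rfl | h43
      · exact existsDesign_forty_three
      by_cases 4 ≤ u ∧ u ≤ 5
      · exact four 1 (by norm_num) (by norm_num) (by omega) (by omega)
      by_cases 5 ≤ u ∧ u ≤ 6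
      · exact five 1 (by norm_num) (by norm_num) (by omega) (by omega)
      by_cases 20 ≤ u ∧ u ≤ 25
      · exact four 5 (by norm_num) (by norm_num) (by omega) (by omega)
      by_cases 25 ≤ u ∧ u ≤ 30
      · exact five 5 (by norm_num) (by norm_num) (by omega) (by omega)
      by_cases 28 ≤ u ∧ u ≤ 35
      · exact four 7 (by norm_num) (by norm_num) (by omega) (by omega)
      by_cases 35 ≤ u ∧ u ≤ 42
      · exact five 7 (by norm_num) (by norm_num) (by omega) (by omega)
      by_cases 44 ≤ u ∧ u ≤ 55
      · exact four 11 (by norm_num) (by norm_num) (by omega) (by omega)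
      by_cases 52 ≤ u ∧ u ≤ 65
      · exact four 13 (by norm_num) (by norm_num) (by omega) (by omega)
      by_cases 65 ≤ u ∧ u ≤ 78
      · exact five 13 (by norm_num) (by norm_num) (by omega) (by omega)
      by_cases 76 ≤ u ∧ u ≤ 95
      · exact four 19 (by norm_num) (by norm_num) (by omega) (by omega)
      · exact four 23 (by norm_num) (by norm_num) (by omega) (by omega)
    · refine four (6 * ((u - 4) / 24) + 1) ?_ (by omega) (by omega) (by omega)
      simp

theorem exists_existsDesign_many_triples :
    ∃ C : ℕ, ∀ u, ∃ k, ExistsDesign u k ∧ 19 * u ^ 2 ≤ 40 * k + C * u := by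
  refine ⟨190000, fun u => ?_⟩
  induction u using Nat.strong_induction_on with
  | _ u ih =>
    rcases lt_or_ge u 10000 with hu | hu
    · exact ⟨0, existsDesign_zero_triples u, by nlinarith⟩
    · obtain ⟨n, t, rfl, hn, ht⟩ : ∃ n t, u = 5 * n + t ∧ n.Coprime 6 ∧ t < 30 :=
        ⟨6 * ((u - 5) / 30) + 1, (u - 5) % 30, by omega, by simp, by omega⟩
      obtain ⟨k, hk, hle⟩ := ih n (by omega)
      refine ⟨_, ExistsDesign.five_mul_add_of_coprime hn (by omega) hk
        (existsDesign_zero_triples t), ?_⟩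
      obtain ⟨s, rfl⟩ : ∃ s, n = t + s := ⟨n - t, by omega⟩
      rw [Nat.add_sub_cancel_left]
      nlinarith

/-- For every `ε > 0` there is `v₀` such that for every
`v > v₀` with `v ≡ 1 (mod 3)` there is a `2-(v,4,1)DD` (with `v(v-1)/6` blocks)
whose every defining set contains at least `(5/8 - c/v)·(v(v-1)/6)` blocks,
where `c = 13/8 + ε`. -/
theorem stmt11 (ε : ℝ) (hε : 0 < ε) :
    ∃ v₀ : ℕ, ∀ v : ℕ, v₀ < v → v % 3 = 1 →
      ∃ B : Multiset (List (Fin v)),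
        IsDD 2 4 1 B ∧
        (Multiset.card B : ℝ) = (v : ℝ) * ((v : ℝ) - 1) / 6 ∧
        ∀ S : Multiset (List (Fin v)), IsDefiningSet 2 4 1 B S →
          (5 / 8 - (13 / 8 + ε) / (v : ℝ)) * ((v : ℝ) * ((v : ℝ) - 1) / 6)
            ≤ (Multiset.card S : ℝ) := by
  obtain ⟨C, hC⟩ := exists_existsDesign_many_triples
  refine ⟨3 * (4 * C + 25) + 1, fun v hv hmod => ?_⟩
  obtain ⟨u, rfl⟩ : ∃ u, v = 3 * u + 1 := ⟨v / 3, by omega⟩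
  obtain ⟨k, ⟨B, hB, hk⟩, hle⟩ := hC u
  refine ⟨B, hB.isDD, ?_, fun S hS => ?_⟩
  · have h := hB.card_eq
    rw [Fintype.card_fin, Nat.add_sub_cancel] at h
    have h' : (6 : ℝ) * Multiset.card B = (3 * u + 1) * (3 * u) := by exact_mod_cast h
    push_cast
    linarith
  · have h1 : 2 * (k : ℝ) ≤ Multiset.card S := by exact_mod_cast hS.two_mul_le_card hB.isDD hk
    have h2 : 19 * (u : ℝ) ^ 2 ≤ 40 * k + C * u := by exact_mod_cast hle
    have h3 : 4 * (C : ℝ) + 25 ≤ u := by exact_mod_cast (by omega : 4 * C + 25 ≤ u)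
    have hu : (0 : ℝ) ≤ u := Nat.cast_nonneg u
    have h4 : (4 * (C : ℝ) + 25) * u ≤ u * u := mul_le_mul_of_nonneg_right h3 hu
    push_cast
    have h5 : 0 ≤ (13 / 8 + ε) / (3 * (u : ℝ) + 1) := by positivity
    calc (5 / 8 - (13 / 8 + ε) / (3 * (u : ℝ) + 1)) * ((3 * u + 1) * (3 * u + 1 - 1) / 6)
        ≤ 5 / 8 * ((3 * u + 1) * (3 * u + 1 - 1) / 6) := by
          refine mul_le_mul_of_nonneg_right (by linarith) ?_
          rw [add_sub_cancel_right]
          positivity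
      _ ≤ Multiset.card S := by nlinarith
end

section
/- There exists a super-simple 2-(10,4,1) directed design (which has 15 blocks) whose smallest defining sets have exactly 8 blocks; in particular its smallest defining sets contain more than half of the blocks. -/
open scoped Classical

theorem List.exists_pair_of_nodup_of_length_eq_two {α : Type*} {s : List α} (hs : s.Nodup)
    (hl : s.length = 2) : ∃ x y, x ≠ y ∧ s = [x, y] := by
  obtain ⟨x, y, rfl⟩ := List.length_eq_two.mp hl
  exact ⟨x, y, by simpa using hs, rfl⟩

theorem isDD_two_coe {α : Type*} [DecidableEq α] {k lam : ℕ} {L : List (List α)}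
    (hblock : ∀ b ∈ L, b.Nodup ∧ b.length = k)
    (hcount : ∀ x y : α, x ≠ y →
      L.countP (fun b => decide ([x, y].Sublist b)) = lam) :
    IsDD 2 k lam (L : Multiset (List α)) := by
  refine ⟨fun b hb => hblock b (by simpa using hb), fun s hs hl => ?_⟩
  obtain ⟨x, y, hxy, rfl⟩ := List.exists_pair_of_nodup_of_length_eq_two hs hl
  rw [Multiset.coe_countP, ← hcount x y hxy]
  exact List.countP_congr fun b _ => by simp

theorem isTrade_two_coe {α : Type*} [DecidableEq α] {k s : ℕ} {L₁ L₂ : List (List α)}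
    (hs : 1 ≤ s) (h₁ : L₁.length = s) (h₂ : L₂.length = s)
    (hblock₁ : ∀ b ∈ L₁, b.Nodup ∧ b.length = k)
    (hblock₂ : ∀ b ∈ L₂, b.Nodup ∧ b.length = k)
    (hdisj : ∀ b ∈ L₁, b ∉ L₂)
    (hcount : ∀ x y : α, x ≠ y → L₁.countP (fun b => decide ([x, y].Sublist b)) =
      L₂.countP (fun b => decide ([x, y].Sublist b))) :
    IsTrade 2 k s (L₁ : Multiset (List α)) (L₂ : Multiset (List α)) := by
  refine ⟨hs, by simpa using h₁, by simpa using h₂, fun b hb => hblock₁ b (by simpa using hb),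
    fun b hb => hblock₂ b (by simpa using hb), by simpa using hdisj, fun l hl hlen => ?_⟩
  obtain ⟨x, y, hxy, rfl⟩ := List.exists_pair_of_nodup_of_length_eq_two hl hlen
  rw [Multiset.coe_countP, Multiset.coe_countP]
  convert hcount x y hxy

/-- A defining set meets every trade contained in the design. -/
theorem IsDefiningSet.exists_mem_of_isTrade {α : Type*} {t k lam s : ℕ}
    {B S T₁ T₂ : Multiset (List α)} (hB : IsDD t k lam B) (hS : IsDefiningSet t k lam B S)
    (hT : IsTrade t k s T₁ T₂) (hle : T₁ ≤ B) : ∃ b ∈ T₁, b ∈ S := by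
  obtain ⟨hs, hcard₁, -, -, hblock₂, hdisj, hcount⟩ := hT
  obtain ⟨R, rfl⟩ := Multiset.le_iff_exists_add.mp hle
  by_contra! hmiss
  have hSR : S ≤ T₂ + R := by
    refine le_trans (Multiset.le_iff_count.mpr fun b => ?_) (Multiset.le_add_left R T₂)
    by_cases hb : b ∈ T₁
    · simp [Multiset.count_eq_zero_of_notMem (hmiss b hb)]
    · simpa [Multiset.count_eq_zero_of_notMem hb] using Multiset.le_iff_count.mp hS.1 b
  have hDD : IsDD t k lam (T₂ + R) := by
    refine ⟨fun b hb => ?_, fun l hl hlen => ?_⟩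
    · rcases Multiset.mem_add.mp hb with hb | hb
      · exact hblock₂ b hb
      · exact hB.1 b (Multiset.mem_add.mpr (Or.inr hb))
    · rw [Multiset.countP_add, ← hcount l hl hlen, ← Multiset.countP_add]
      exact hB.2 l hl hlen
  have heq : T₂ = T₁ := by simpa using hS.2 _ hDD hSR
  obtain ⟨b, hb⟩ := Multiset.card_pos_iff_exists_mem.mp (by omega : 0 < Multiset.card T₁)
  exact hdisj b hb (heq ▸ hb)

/-- Two blocks of a `2-(v,k,1)DD` share no ordered pair. -/
theorem IsDD.not_sublist_of_cons_le {α : Type*} {k : ℕ} {B : Multiset (List α)}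
    (hB : IsDD 2 k 1 B) {b : List α} {K : Multiset (List α)} (hle : b ::ₘ K ≤ B)
    {x y : α} (hxy : x ≠ y) (hb : [x, y].Sublist b) : ∀ c ∈ K, ¬ [x, y].Sublist c := by
  intro c hc hxyc
  have h := Multiset.countP_le_of_le (fun b => [x, y].Sublist b) hle
  rw [hB.2 [x, y] (by simpa using hxy) rfl, Multiset.countP_cons_of_pos _ hb] at h
  have := Multiset.countP_pos.mpr ⟨c, hc, hxyc⟩
  omega

/-- An ordered pair not covered by a part `K` of a `2-(v,k,1)DD` is covered by a further block. -/
theorem IsDD.exists_cons_le {α : Type*} {k : ℕ} {B K : Multiset (List α)}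
    (hB : IsDD 2 k 1 B) (hK : K ≤ B) {x y : α} (hxy : x ≠ y)
    (hnew : ∀ c ∈ K, ¬ [x, y].Sublist c) :
    ∃ b, IsBlock k b ∧ [x, y].Sublist b ∧ b ::ₘ K ≤ B := by
  obtain ⟨R, rfl⟩ := Multiset.le_iff_exists_add.mp hK
  have hcount := hB.2 [x, y] (by simpa using hxy) rfl
  obtain ⟨b, hb, hxyb⟩ := Multiset.countP_pos.mp (by omega :
    0 < (K + R).countP (fun b => [x, y].Sublist b))
  refine ⟨b, hB.1 b hb, hxyb, ?_⟩
  have hbR : b ∈ R := (Multiset.mem_add.mp hb).resolve_left fun h => hnew b h hxyb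
  obtain ⟨Q, rfl⟩ := Multiset.exists_cons_of_mem hbR
  rw [Multiset.add_cons]
  exact Multiset.cons_le_cons b (Multiset.le_add_right K Q)

/-- A `2-(v,k,1)DD` with `k ≥ 2` is not properly contained in another one. -/
theorem IsDD.eq_of_le {α : Type*} {k : ℕ} (hk : 2 ≤ k) {B B' : Multiset (List α)}
    (hB : IsDD 2 k 1 B) (hB' : IsDD 2 k 1 B') (hle : B ≤ B') : B' = B := by
  obtain ⟨R, rfl⟩ := Multiset.le_iff_exists_add.mp hle
  suffices R = 0 by simp [this]
  refine Multiset.eq_zero_of_forall_notMem fun b hb => ?_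
  obtain ⟨hnodup, hlen⟩ := hB'.1 b (Multiset.mem_add.mpr (Or.inr hb))
  have htake : (b.take 2).Sublist b := List.take_sublist 2 b
  have hn := hnodup.sublist htake
  have hl : (b.take 2).length = 2 := by simp [hlen, hk]
  have h := hB'.2 _ hn hl
  rw [Multiset.countP_add, hB.2 _ hn hl] at h
  have : 0 < R.countP (fun c => (b.take 2).Sublist c) := Multiset.countP_pos.mpr ⟨b, hb, htake⟩
  omega

/-- The ordered pair `(x, y)` of distinct points appears in no member of `K`. -/
def IsFreePair {α : Type*} (K : List (List α)) (x y : α) : Prop :=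
  x ≠ y ∧ ∀ c ∈ K, ¬ [x, y].Sublist c

instance {α : Type*} [DecidableEq α] (K : List (List α)) (x y : α) :
    Decidable (IsFreePair K x y) :=
  inferInstanceAs (Decidable (_ ∧ _))

/-- If a pair not covered by the known blocks `K` of a `2-(v,4,1)DD` lies in only one block `b`
compatible with `K`, then `b` is a further block of the design. -/
theorem IsDD.cons_le_of_forced {α : Type*} {B : Multiset (List α)} (hB : IsDD 2 4 1 B)
    {K : List (List α)} (hK : (K : Multiset (List α)) ≤ B) (x y : α) (b : List α)
    (hnew : IsFreePair K x y)
    (hforced : ∀ p q, IsFreePair K p q → ∀ r, IsFreePair K p r → IsFreePair K q r →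
      ∀ s, IsFreePair K p s → IsFreePair K q s → IsFreePair K r s →
        [x, y].Sublist [p, q, r, s] → [p, q, r, s] = b) :
    ((b :: K : List (List α)) : Multiset (List α)) ≤ B := by
  obtain ⟨c, ⟨hnodup, hlen⟩, hxyc, hle⟩ := hB.exists_cons_le hK hnew.1 (by simpa using hnew.2)
  have hfree : ∀ u v, [u, v].Sublist c → IsFreePair K u v := fun u v huv => by
    have huv_ne : u ≠ v := by simpa using hnodup.sublist huv
    exact ⟨huv_ne, by simpa using hB.not_sublist_of_cons_le hle huv_ne huv⟩
  match c, hlen with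
  | [p, q, r, s], _ =>
    have := hforced p q (hfree p q (by simp)) r (hfree p r (by simp)) (hfree q r (by simp)) s
      (hfree p s (by simp)) (hfree q s (by simp)) (hfree r s (by simp)) hxyc
    rw [← this]
    exact hle

/-- Eight blocks that determine the whole design `designBlocks`. -/
def definingBlocks : List (List (Fin 10)) :=
  [[4, 0, 1, 5], [0, 4, 2, 6], [5, 0, 3, 8], [6, 0, 7, 9], [8, 9, 2, 1],
   [3, 7, 6, 1], [1, 8, 7, 4], [2, 9, 3, 4]]

/-- The fifteen blocks of a super-simple `2-(10,4,1)DD`. -/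
def designBlocks : List (List (Fin 10)) :=
  [[9, 8, 6, 5], [5, 4, 9, 7], [6, 4, 8, 3], [2, 7, 8, 0], [7, 3, 2, 5],
   [5, 1, 6, 2], [1, 3, 9, 0]] ++ definingBlocks

theorem isDD_designBlocks : IsDD 2 4 1 (designBlocks : Multiset (List (Fin 10))) :=
  isDD_two_coe (by decide +kernel) (by decide +kernel)

theorem superSimple_designBlocks :
    SuperSimple (designBlocks : Multiset (List (Fin 10))) := by
  intro b c hle
  have hpair : ∀ b ∈ designBlocks, ∀ c ∈ designBlocks, [b, c].Subperm designBlocks →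
      (b.toFinset ∩ c.toFinset).card ≤ 2 := by
    decide +kernel
  have hsub : [b, c].Subperm designBlocks := hle
  convert hpair b (hsub.subset (by simp)) c (hsub.subset (by simp)) hsub

theorem isDefiningSet_definingBlocks :
    IsDefiningSet 2 4 1 (designBlocks : Multiset (List (Fin 10))) definingBlocks := by
  refine ⟨List.Sublist.subperm (List.sublist_append_right _ _), fun B hB h0 => ?_⟩
  have h1 := hB.cons_le_of_forced h0 3 9 [1, 3, 9, 0] (by decide +kernel) (by decide +kernel)
  have h2 := hB.cons_le_of_forced h1 1 2 [5, 1, 6, 2] (by decide +kernel) (by decide +kernel)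
  have h3 := hB.cons_le_of_forced h2 3 2 [7, 3, 2, 5] (by decide +kernel) (by decide +kernel)
  have h4 := hB.cons_le_of_forced h3 2 0 [2, 7, 8, 0] (by decide +kernel) (by decide +kernel)
  have h5 := hB.cons_le_of_forced h4 4 3 [6, 4, 8, 3] (by decide +kernel) (by decide +kernel)
  have h6 := hB.cons_le_of_forced h5 4 7 [5, 4, 9, 7] (by decide +kernel) (by decide +kernel)
  have h7 := hB.cons_le_of_forced h6 6 5 [9, 8, 6, 5] (by decide +kernel) (by decide +kernel)
  exact isDD_designBlocks.eq_of_le (by norm_num) hB h7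

/-- If the points `x` and `y` are swapped in two blocks of a design, and this is a trade, then a
defining set contains one of the two blocks. -/
theorem one_le_count_add_count {S : Multiset (List (Fin 10))}
    (hS : IsDefiningSet 2 4 1 (designBlocks : Multiset (List (Fin 10))) S) (x y : Fin 10)
    (b c : List (Fin 10)) (hle : [b, c].Subperm designBlocks)
    (hdisj : ∀ d ∈ [b, c], d ∉ [b, c].map (List.map (Equiv.swap x y)))
    (hcount : ∀ u v : Fin 10, u ≠ v → [b, c].countP (fun d => decide ([u, v].Sublist d)) =
      ([b, c].map (List.map (Equiv.swap x y))).countP (fun d => decide ([u, v].Sublist d))) :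
    1 ≤ S.count b + S.count c := by
  have hblock : ∀ d ∈ [b, c], d.Nodup ∧ d.length = 4 := fun d hd =>
    isDD_designBlocks.1 d (hle.subset hd)
  have hT := isTrade_two_coe (k := 4) (by norm_num : 1 ≤ 2) rfl rfl hblock
    (L₂ := [b, c].map (List.map (Equiv.swap x y)))
    (fun d hd => by
      obtain ⟨e, he, rfl⟩ := List.mem_map.mp hd
      exact ⟨(hblock e he).1.map (Equiv.injective _), by simpa using (hblock e he).2⟩)
    hdisj hcount
  obtain ⟨d, hd, hdS⟩ := hS.exists_mem_of_isTrade isDD_designBlocks hT hle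
  have := Multiset.one_le_count_iff_mem.mpr hdS
  have hd' : d = b ∨ d = c := by simpa using hd
  rcases hd' with rfl | rfl <;> omega

theorem eight_le_card_of_isDefiningSet {S : Multiset (List (Fin 10))}
    (hS : IsDefiningSet 2 4 1 (designBlocks : Multiset (List (Fin 10))) S) :
    8 ≤ Multiset.card S := by
  have hnodup : designBlocks.Nodup := by decide +kernel
  have hcard : (designBlocks.map S.count).sum = Multiset.card S := by
    rw [← Multiset.sum_count_eq_card (s := designBlocks.toFinset) (m := S)
      fun b hb => by simpa using Multiset.mem_of_le hS.1 hb]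
    rw [List.sum_toFinset _ hnodup]
  have h0_2 := one_le_count_add_count hS 0 4 [4, 0, 1, 5] [0, 4, 2, 6]
    (by decide +kernel) (by decide +kernel) (by decide +kernel)
  have h0_6 := one_le_count_add_count hS 1 5 [4, 0, 1, 5] [5, 1, 6, 2]
    (by decide +kernel) (by decide +kernel) (by decide +kernel)
  have h2_6 := one_le_count_add_count hS 2 6 [0, 4, 2, 6] [5, 1, 6, 2]
    (by decide +kernel) (by decide +kernel) (by decide +kernel)
  have h1_10 := one_le_count_add_count hS 3 9 [1, 3, 9, 0] [2, 9, 3, 4]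
    (by decide +kernel) (by decide +kernel) (by decide +kernel)
  have h3_9 := one_le_count_add_count hS 7 8 [2, 7, 8, 0] [1, 8, 7, 4]
    (by decide +kernel) (by decide +kernel) (by decide +kernel)
  have h4_12 := one_le_count_add_count hS 3 8 [5, 0, 3, 8] [6, 4, 8, 3]
    (by decide +kernel) (by decide +kernel) (by decide +kernel)
  have h5_13 := one_le_count_add_count hS 7 9 [6, 0, 7, 9] [5, 4, 9, 7]
    (by decide +kernel) (by decide +kernel) (by decide +kernel)
  have h7_14 := one_le_count_add_count hS 8 9 [8, 9, 2, 1] [9, 8, 6, 5]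
    (by decide +kernel) (by decide +kernel) (by decide +kernel)
  have h8_11 := one_le_count_add_count hS 3 7 [3, 7, 6, 1] [7, 3, 2, 5]
    (by decide +kernel) (by decide +kernel) (by decide +kernel)
  simp only [designBlocks, definingBlocks, List.cons_append, List.nil_append, List.map_cons,
    List.map_nil, List.sum_cons, List.sum_nil] at hcard
  omega

/-- There is a super-simple `2-(10,4,1)DD` (with 15 blocks)
whose smallest defining sets have exactly 8 blocks: some defining set has 8
blocks and every defining set has at least 8 blocks (in particular, more than
half of the 15 blocks). -/
theorem stmt12 :
    ∃ B : Multiset (List (Fin 10)),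
      IsDD 2 4 1 B ∧ SuperSimple B ∧ Multiset.card B = 15 ∧
      (∃ S : Multiset (List (Fin 10)), IsDefiningSet 2 4 1 B S ∧
        Multiset.card S = 8) ∧
      ∀ S : Multiset (List (Fin 10)), IsDefiningSet 2 4 1 B S →
        8 ≤ Multiset.card S := by
  exact ⟨designBlocks, isDD_designBlocks, superSimple_designBlocks, rfl,
    ⟨definingBlocks, isDefiningSet_definingBlocks, rfl⟩,
    fun S hS => eight_le_card_of_isDefiningSet hS⟩
end

section
/- There exists a super-simple 2-(13,4,1) directed design (which has 26 blocks) whose smallest defining sets contain at least 13 blocks, i.e. at least half of the blocks. -/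
open scoped Classical

/-- The sub-multisets of a design that avoid one leg of a trade inside it are not defining sets. -/
theorem IsDefiningSet.not_disjoint_of_isTrade {α : Type*} {t k lam s : ℕ}
    {B S T₁ T₂ : Multiset (List α)} (hB : IsDD t k lam B) (hS : IsDefiningSet t k lam B S)
    (hle : T₁ ≤ B) (hT : IsTrade t k s T₁ T₂) : ∃ b ∈ T₁, b ∈ S := by
  by_contra! hdisj
  obtain ⟨hs, hcard₁, -, -, hblock, hne, hcount⟩ := hT
  obtain ⟨C, rfl⟩ := Multiset.le_iff_exists_add.mp hle
  have hSC : S ≤ C := by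
    rw [Multiset.le_iff_count]
    intro b
    by_cases hb : b ∈ T₁
    · simp [Multiset.count_eq_zero_of_notMem (hdisj b hb)]
    · have h := Multiset.le_iff_count.mp hS.1 b
      rwa [Multiset.count_add, Multiset.count_eq_zero_of_notMem hb, zero_add] at h
  have hDD : IsDD t k lam (T₂ + C) := by
    refine ⟨fun b hb => ?_, fun l hl hlen => ?_⟩
    · rcases Multiset.mem_add.mp hb with h | h
      · exact hblock b h
      · exact hB.1 b (Multiset.mem_add.mpr (Or.inr h))
    · rw [Multiset.countP_add, ← hcount l hl hlen, ← Multiset.countP_add]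
      exact hB.2 l hl hlen
  have heq := add_right_cancel (hS.2 _ hDD (hSC.trans (Multiset.le_add_left C T₂)))
  obtain ⟨b, hb⟩ := Multiset.card_pos_iff_exists_mem.mp (hs.trans_eq hcard₁.symm)
  exact hne b hb (heq ▸ hb)

/-- A list of length two without repetitions consists of two distinct points. -/
theorem List.exists_eq_pair_of_nodup {α : Type*} {l : List α} (h : l.Nodup)
    (hlen : l.length = 2) : ∃ x y, x ≠ y ∧ l = [x, y] := by
  obtain ⟨x, y, rfl⟩ := List.length_eq_two.mp hlen
  exact ⟨x, y, by simpa using h, rfl⟩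

/-- The blocks containing a given subsequence can be counted with the boolean subsequence test. -/
theorem countP_sublist_eq_countP_isSublist {α : Type*} [BEq α] [LawfulBEq α]
    (l : List α) (L : List (List α)) :
    (L : Multiset (List α)).countP (fun b => l.Sublist b) =
      L.countP (fun b => l.isSublist b) := by
  rw [Multiset.coe_countP]
  refine List.countP_congr fun b _ => ?_
  rw [decide_eq_true_iff, List.isSublist_iff_sublist]

/-- The translates of the first base block of a cyclic directed design on `ℤ/13ℤ`. -/
def fwdBlock (i : Fin 13) : List (Fin 13) := [i, i + 1, i + 3, i + 9]

/-- The translates of the second base block of a cyclic directed design on `ℤ/13ℤ`. -/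
def bwdBlock (i : Fin 13) : List (Fin 13) := [i + 1, i, i + 11, i + 5]

/-- The cyclic directed design on `ℤ/13ℤ` with base blocks `fwdBlock 0` and `bwdBlock 0`. -/
def cyclicDesign : Multiset (List (Fin 13)) :=
  ↑((List.finRange 13).flatMap fun i => [fwdBlock i, bwdBlock i])

theorem nodup_cyclicDesign : cyclicDesign.Nodup := by
  rw [cyclicDesign, Multiset.coe_nodup]
  decide +kernel

theorem mem_cyclicDesign {b : List (Fin 13)} :
    b ∈ cyclicDesign ↔ ∃ i, b = fwdBlock i ∨ b = bwdBlock i := by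
  simp [cyclicDesign]

theorem isBlock_fwdBlock (i : Fin 13) : IsBlock 4 (fwdBlock i) :=
  ⟨by revert i; decide +kernel, rfl⟩

theorem isBlock_bwdBlock (i : Fin 13) : IsBlock 4 (bwdBlock i) :=
  ⟨by revert i; decide +kernel, rfl⟩

theorem isDD_cyclicDesign : IsDD 2 4 1 cyclicDesign := by
  refine ⟨fun b hb => ?_, fun l hl hlen => ?_⟩
  · obtain ⟨i, rfl | rfl⟩ := mem_cyclicDesign.mp hb
    · exact isBlock_fwdBlock i
    · exact isBlock_bwdBlock i
  · obtain ⟨x, y, hxy, rfl⟩ := List.exists_eq_pair_of_nodup hl hlen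
    have h : ∀ x y : Fin 13, x ≠ y → List.countP (fun b => [x, y].isSublist b)
        ((List.finRange 13).flatMap fun i => [fwdBlock i, bwdBlock i]) = 1 := by
      decide +kernel
    exact (countP_sublist_eq_countP_isSublist _ _).trans (h x y hxy)

theorem superSimple_cyclicDesign : SuperSimple cyclicDesign := by
  intro b₁ b₂ hle
  have hne : b₁ ≠ b₂ := by simpa using Multiset.nodup_of_le hle nodup_cyclicDesign
  have h : ∀ b₁ ∈ (List.finRange 13).flatMap fun i => [fwdBlock i, bwdBlock i],
      ∀ b₂ ∈ (List.finRange 13).flatMap fun i => [fwdBlock i, bwdBlock i],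
      b₁ ≠ b₂ → (b₁.toFinset ∩ b₂.toFinset).card ≤ 2 := by
    decide +kernel
  convert h b₁ (Multiset.mem_of_le hle (by simp)) b₂ (Multiset.mem_of_le hle (by simp)) hne

/-- Interchanging `i` and `i + 1` in the two blocks where they are adjacent gives a trade. -/
theorem isTrade_cyclicDesign (i : Fin 13) :
    IsTrade 2 4 2 {fwdBlock i, bwdBlock i}
      {[i + 1, i, i + 3, i + 9], [i, i + 1, i + 11, i + 5]} := by
  refine ⟨by norm_num, rfl, rfl, ?_, ?_, ?_, fun l hl hlen => ?_⟩
  · simp [isBlock_fwdBlock, isBlock_bwdBlock]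
  · have h : ∀ i : Fin 13, [i + 1, i, i + 3, i + 9].Nodup ∧ [i, i + 1, i + 11, i + 5].Nodup := by
      decide +kernel
    simp only [Multiset.insert_eq_cons, Multiset.mem_cons, Multiset.mem_singleton]
    rintro b (rfl | rfl)
    · exact ⟨(h i).1, rfl⟩
    · exact ⟨(h i).2, rfl⟩
  · have h : ∀ i : Fin 13, ∀ b ∈ [fwdBlock i, bwdBlock i],
        b ∉ [[i + 1, i, i + 3, i + 9], [i, i + 1, i + 11, i + 5]] := by
      decide +kernel
    simpa using h i
  · obtain ⟨x, y, hxy, rfl⟩ := List.exists_eq_pair_of_nodup hl hlen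
    have h : ∀ i x y : Fin 13, x ≠ y →
        List.countP (fun b => [x, y].isSublist b) [fwdBlock i, bwdBlock i] =
        List.countP (fun b => [x, y].isSublist b)
          [[i + 1, i, i + 3, i + 9], [i, i + 1, i + 11, i + 5]] := by
      decide +kernel
    exact (countP_sublist_eq_countP_isSublist _ _).trans
      ((h i x y hxy).trans (countP_sublist_eq_countP_isSublist _ _).symm)

theorem le_card_of_isDefiningSet_cyclicDesign {S : Multiset (List (Fin 13))}
    (hS : IsDefiningSet 2 4 1 cyclicDesign S) : 13 ≤ Multiset.card S := by
  have hmem : ∀ i, ∃ b ∈ ({fwdBlock i, bwdBlock i} : Multiset (List (Fin 13))), b ∈ S := by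
    intro i
    have hne : ∀ i, fwdBlock i ≠ bwdBlock i := by decide +kernel
    refine hS.not_disjoint_of_isTrade isDD_cyclicDesign ?_ (isTrade_cyclicDesign i)
    rw [Multiset.le_iff_subset (by simpa using hne i)]
    intro b hb
    exact mem_cyclicDesign.mpr ⟨i, by simpa using hb⟩
  choose f hf hfS using hmem
  have hinj : Function.Injective f := by
    have h : ∀ i j : Fin 13, ∀ b ∈ [fwdBlock i, bwdBlock i], b ∈ [fwdBlock j, bwdBlock j] →
        i = j := by
      decide +kernel
    intro i j hij
    exact h i j (f i) (by simpa using hf i) (by simpa [hij] using hf j)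
  calc 13 = (Finset.univ.image f).card := by simp [Finset.card_image_of_injective _ hinj]
    _ ≤ S.toFinset.card := Finset.card_le_card fun b hb => by
        obtain ⟨i, -, rfl⟩ := Finset.mem_image.mp hb
        exact Multiset.mem_toFinset.mpr (hfS i)
    _ ≤ Multiset.card S := Multiset.toFinset_card_le S

/-- There is a super-simple `2-(13,4,1)DD` (with 26 blocks)
whose every defining set contains at least 13 blocks, i.e. at least half of the
blocks. -/
theorem stmt13 :
    ∃ B : Multiset (List (Fin 13)),
      IsDD 2 4 1 B ∧ SuperSimple B ∧ Multiset.card B = 26 ∧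
      ∀ S : Multiset (List (Fin 13)), IsDefiningSet 2 4 1 B S →
        13 ≤ Multiset.card S := by
  exact ⟨cyclicDesign, isDD_cyclicDesign, superSimple_cyclicDesign, rfl,
    fun _ hS => le_card_of_isDefiningSet_cyclicDesign hS⟩
end

section
/- There exists a super-simple 4-DGDD of type 3^4 (on 12 points partitioned into 4 groups of size 3, necessarily having 18 blocks) whose smallest defining sets contain at least 10 blocks, i.e. at least 5/9 of the blocks. -/
open scoped Classical

section Trades

variable {β : Type*}

theorem pair_sublist_swap_iff {u v x y : β} (l r : List β)
    (h₁ : ¬(u = x ∧ v = y)) (h₂ : ¬(u = y ∧ v = x)) :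
    [u, v].Sublist (l ++ x :: y :: r) ↔ [u, v].Sublist (l ++ y :: x :: r) := by
  induction l with
  | nil =>
    simp only [List.nil_append, List.cons_sublist_cons', List.singleton_sublist]
    grind
  | cons a l ih =>
    simp only [List.cons_append, List.cons_sublist_cons', List.singleton_sublist,
      List.mem_append, List.mem_cons, ih]
    grind

theorem pair_sublist_append_s17 (x y : β) (l r : List β) :
    [x, y].Sublist (l ++ x :: y :: r) :=
  List.sublist_append_of_sublist_right
    ((List.nil_sublist r).cons_cons y |>.cons_cons x)

theorem not_pair_sublist_of_nodup_s17 {x y : β} {l r : List β} (h : (l ++ x :: y :: r).Nodup) :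
    ¬[y, x].Sublist (l ++ x :: y :: r) := by
  induction l with
  | nil =>
    simp only [List.nil_append, List.cons_sublist_cons', List.singleton_sublist,
      List.mem_cons, List.nodup_cons] at h ⊢
    have := fun k : [y, x].Sublist r => k.subset (List.mem_cons_self)
    grind
  | cons a l ih =>
    simp only [List.cons_append, List.nodup_cons] at h
    simp only [List.cons_append, List.cons_sublist_cons', List.singleton_sublist, not_or]
    refine ⟨ih h.2, ?_⟩
    rintro ⟨rfl, -⟩
    exact h.1 (by simp)

/-- Two blocks containing the same two points consecutively, in opposite orders, form a
directed trade: interchanging the two points in both blocks preserves the `4`-DGDD. -/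
theorem IsDGDD.swap {Gs : Multiset (Finset β)} {R : Multiset (List β)}
    {l₁ r₁ l₂ r₂ : List β} {x y : β}
    (h : IsDGDD Gs ((l₁ ++ x :: y :: r₁) ::ₘ (l₂ ++ y :: x :: r₂) ::ₘ R)) :
    IsDGDD Gs ((l₁ ++ y :: x :: r₁) ::ₘ (l₂ ++ x :: y :: r₂) ::ₘ R) := by
  obtain ⟨hG, hb, hi, hp⟩ := h
  have perm (l r : List β) (a b : β) : (l ++ a :: b :: r).Perm (l ++ b :: a :: r) :=
    (List.Perm.swap b a r).append_left l
  have block {l r : List β} {a b : β} (hB : IsBlock 4 (l ++ a :: b :: r)) :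
      IsBlock 4 (l ++ b :: a :: r) :=
    ⟨(perm l r a b).nodup_iff.1 hB.1, (perm l r a b).length_eq.symm.trans hB.2⟩
  simp only [Multiset.mem_cons, forall_eq_or_imp] at hb hi
  refine ⟨hG, ?_, ?_, fun u v huv hg => ?_⟩
  · simp only [Multiset.mem_cons, forall_eq_or_imp]
    exact ⟨block hb.1, block hb.2.1, hb.2.2⟩
  · simp only [Multiset.mem_cons, forall_eq_or_imp]
    rw [List.toFinset_eq_of_perm _ _ (perm l₁ r₁ y x),
      List.toFinset_eq_of_perm _ _ (perm l₂ r₂ x y)]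
    exact hi
  · rw [← hp u v huv hg]
    simp only [Multiset.countP_cons]
    by_cases h₁ : u = x ∧ v = y
    · obtain ⟨rfl, rfl⟩ := h₁
      simp [not_pair_sublist_of_nodup_s17 hb.2.1.1,
        not_pair_sublist_of_nodup_s17 (block hb.1).1]
    by_cases h₂ : u = y ∧ v = x
    · obtain ⟨rfl, rfl⟩ := h₂
      simp [not_pair_sublist_of_nodup_s17 hb.1.1,
        not_pair_sublist_of_nodup_s17 (block hb.2.1).1]
    simp only [pair_sublist_swap_iff l₁ r₁ h₁ h₂, pair_sublist_swap_iff l₂ r₂ h₁ h₂]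

/-- A defining set meets every directed trade of volume two. -/
theorem IsDGDDDefiningSet.mem_or_mem {Gs : Multiset (Finset β)} {B S : Multiset (List β)}
    {l₁ r₁ l₂ r₂ : List β} {x y : β} (hS : IsDGDDDefiningSet Gs B S) (hB : IsDGDD Gs B)
    (h₁ : l₁ ++ x :: y :: r₁ ∈ B) (h₂ : l₂ ++ y :: x :: r₂ ∈ B)
    (h : l₁ ++ y :: x :: r₁ ∉ B) :
    l₁ ++ x :: y :: r₁ ∈ S ∨ l₂ ++ y :: x :: r₂ ∈ S := by
  by_contra! hn
  have hne : l₂ ++ y :: x :: r₂ ≠ l₁ ++ x :: y :: r₁ := fun he =>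
    not_pair_sublist_of_nodup_s17 (hB.2.1 _ h₁).1 (he ▸ pair_sublist_append_s17 y x l₂ r₂)
  obtain ⟨T, rfl⟩ := Multiset.exists_cons_of_mem h₁
  obtain ⟨R, rfl⟩ := Multiset.exists_cons_of_mem
    ((Multiset.mem_cons.1 h₂).resolve_left hne)
  have hle : S ≤ R := (Multiset.le_cons_of_notMem hn.2).1
    ((Multiset.le_cons_of_notMem hn.1).1 hS.1)
  have heq := hS.2 _ hB.swap
    ((hle.trans (Multiset.le_cons_self _ _)).trans (Multiset.le_cons_self _ _))
  exact h (heq ▸ Multiset.mem_cons_self _ _)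

end Trades

/-- The four groups of a `4`-DGDD of type `3⁴`. -/
def dgddGroup : Fin 4 → Finset (Fin 12) :=
  ![{0, 1, 2}, {3, 4, 5}, {6, 7, 8}, {9, 10, 11}]

/-- The group multiset of a `4`-DGDD of type `3⁴`. -/
def dgddGroups : Multiset (Finset (Fin 12)) :=
  List.ofFn dgddGroup

theorem mem_dgddGroups {G : Finset (Fin 12)} : G ∈ dgddGroups ↔ ∃ i, dgddGroup i = G := by
  rw [dgddGroups, Multiset.mem_coe, List.mem_ofFn]

/-- The blocks of a super-simple `4`-DGDD of type `3⁴`. -/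
def dgddBlock : Fin 18 → List (Fin 12) :=
  ![[4, 8, 2, 11], [11, 7, 3, 2], [3, 10, 0, 7], [1, 3, 6, 11],
    [4, 6, 10, 1], [11, 1, 5, 8], [0, 10, 8, 4], [6, 0, 9, 3],
    [5, 2, 7, 9], [7, 11, 4, 0], [9, 2, 6, 4], [8, 9, 0, 5],
    [10, 6, 2, 5], [3, 9, 8, 1], [1, 4, 9, 7], [5, 0, 11, 6],
    [7, 5, 1, 10], [2, 8, 10, 3]]

/-- The block multiset of a super-simple `4`-DGDD of type `3⁴`. -/
def dgddBlocks : Multiset (List (Fin 12)) :=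
  List.ofFn dgddBlock

theorem mem_dgddBlocks {b : List (Fin 12)} : b ∈ dgddBlocks ↔ ∃ i, dgddBlock i = b := by
  rw [dgddBlocks, Multiset.mem_coe, List.mem_ofFn]

theorem dgddBlock_injective : Function.Injective dgddBlock := by
  unfold Function.Injective
  decide +kernel

theorem isDGDD_dgddBlocks :
    IsDGDD dgddGroups dgddBlocks := by
  have hG : ∀ x, (List.ofFn dgddGroup).countP (fun G => x ∈ G) = 1 := by
    decide +kernel
  have hb : ∀ i, (dgddBlock i).Nodup ∧ (dgddBlock i).length = 4 := by decide +kernel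
  have hi : ∀ i j, ((dgddBlock i).toFinset ∩ dgddGroup j).card ≤ 1 := by
    decide +kernel
  have hp : ∀ x y, x ≠ y → (∀ j, ¬(x ∈ dgddGroup j ∧ y ∈ dgddGroup j)) →
      (List.ofFn dgddBlock).countP (fun b => [x, y].Sublist b) = 1 := by
    decide +kernel
  refine ⟨fun x => ?_, ?_, ?_, fun x y hxy hg => ?_⟩
  · rw [dgddGroups, Multiset.coe_countP]
    convert hG x
  · intro b hB
    obtain ⟨i, rfl⟩ := mem_dgddBlocks.1 hB
    exact hb i
  · intro b hB G hG
    obtain ⟨i, rfl⟩ := mem_dgddBlocks.1 hB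
    obtain ⟨j, rfl⟩ := mem_dgddGroups.1 hG
    convert hi i j
  · rw [dgddBlocks, Multiset.coe_countP]
    convert hp x y hxy fun j => hg _ (mem_dgddGroups.2 ⟨j, rfl⟩)

theorem superSimple_dgddBlocks :
    SuperSimple dgddBlocks := by
  have h : ∀ i j, i ≠ j → ((dgddBlock i).toFinset ∩ (dgddBlock j).toFinset).card ≤ 2 := by
    decide +kernel
  intro b₁ b₂ hle
  have hnd : dgddBlocks.Nodup :=
    Multiset.coe_nodup.2 (List.nodup_ofFn.2 dgddBlock_injective)
  have hne : b₁ ≠ b₂ := by simpa using Multiset.nodup_of_le hle hnd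
  obtain ⟨i, rfl⟩ := mem_dgddBlocks.1 (Multiset.mem_of_le hle (Multiset.mem_cons_self _ _))
  obtain ⟨j, rfl⟩ := mem_dgddBlocks.1
    (Multiset.mem_of_le hle (Multiset.mem_cons_of_mem (Multiset.mem_singleton_self _)))
  convert h i j (fun hij => hne (congrArg dgddBlock hij))

/-- Two disjoint triangles and a perfect matching of the remaining twelve blocks in the graph
of volume two trades force ten blocks into every defining set. -/
theorem ten_le_card_of_isDGDDDefiningSet {S : Multiset (List (Fin 12))}
    (hS : IsDGDDDefiningSet dgddGroups dgddBlocks S) :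
    10 ≤ Multiset.card S := by
  set f : Fin 18 → ℕ := fun i => if dgddBlock i ∈ S then 1 else 0 with hf
  have hcard : ∑ i, f i ≤ Multiset.card S := by
    rw [hf, ← Finset.card_filter, ← Finset.card_image_of_injective _ dgddBlock_injective]
    refine (Finset.card_le_card (t := S.toFinset) fun b hb => ?_).trans
      (Multiset.toFinset_card_le S)
    obtain ⟨i, hi, rfl⟩ := Finset.mem_image.1 hb
    exact Multiset.mem_toFinset.2 (Finset.mem_filter.1 hi).2
  have hit (i j : Fin 18) (l₁ r₁ l₂ r₂ : List (Fin 12)) (x y : Fin 12)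
      (hi : dgddBlock i = l₁ ++ x :: y :: r₁) (hj : dgddBlock j = l₂ ++ y :: x :: r₂)
      (h : ∀ k, dgddBlock k ≠ l₁ ++ y :: x :: r₁) : 1 ≤ f i + f j := by
    have := hS.mem_or_mem isDGDD_dgddBlocks (mem_dgddBlocks.2 ⟨i, hi⟩)
      (mem_dgddBlocks.2 ⟨j, hj⟩) (by simpa [mem_dgddBlocks] using h)
    rw [← hi, ← hj] at this
    simp only [hf]
    split_ifs <;> simp_all
  clear_value f
  have triangle (a b c : ℕ) (hab : 1 ≤ a + b) (hbc : 1 ≤ b + c) (hac : 1 ≤ a + c) :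
      2 ≤ a + b + c := by lia
  have := triangle _ _ _
    (hit 4 10 [] [10, 1] [9, 2] [] 4 6 rfl rfl (by decide))
    (hit 10 12 [9] [4] [10] [5] 2 6 rfl rfl (by decide))
    (hit 4 12 [4] [1] [] [2, 5] 6 10 rfl rfl (by decide))
  have := triangle _ _ _
    (hit 7 11 [6] [3] [8] [5] 0 9 rfl rfl (by decide))
    (hit 11 13 [] [0, 5] [3] [1] 8 9 rfl rfl (by decide))
    (hit 7 13 [6, 0] [] [] [8, 1] 9 3 rfl rfl (by decide))
  have := hit 0 6 [] [2, 11] [0, 10] [] 4 8 rfl rfl (by decide)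
  have := hit 1 9 [] [3, 2] [] [4, 0] 11 7 rfl rfl (by decide)
  have := hit 8 14 [5, 2] [] [1, 4] [] 7 9 rfl rfl (by decide)
  have := hit 3 15 [1, 3] [] [5, 0] [] 6 11 rfl rfl (by decide)
  have := hit 5 16 [11] [8] [7] [10] 1 5 rfl rfl (by decide)
  have := hit 2 17 [] [0, 7] [2, 8] [] 3 10 rfl rfl (by decide)
  simp only [Fin.sum_univ_succ, Fin.sum_univ_zero, Fin.succ_zero_eq_one, Fin.reduceSucc] at hcard
  lia

/-- There is a super-simple `4`-DGDD of type `3⁴` (12 points,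
4 groups of size 3, 18 blocks) whose every defining set contains at least 10
blocks, i.e. at least `5/9` of the blocks. -/
theorem stmt17 :
    ∃ (Gs : Multiset (Finset (Fin 12))) (B : Multiset (List (Fin 12))),
      IsDGDD Gs B ∧ Multiset.card Gs = 4 ∧ (∀ G ∈ Gs, G.card = 3) ∧
      SuperSimple B ∧ Multiset.card B = 18 ∧
      ∀ S : Multiset (List (Fin 12)), IsDGDDDefiningSet Gs B S →
        10 ≤ Multiset.card S := by
  have hG : ∀ j, (dgddGroup j).card = 3 := by decide
  refine ⟨dgddGroups, dgddBlocks, isDGDD_dgddBlocks, rfl, fun G hGs => ?_, superSimple_dgddBlocks,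
    List.length_ofFn, fun _ => ten_le_card_of_isDGDDDefiningSet⟩
  obtain ⟨j, rfl⟩ := mem_dgddGroups.1 hGs
  exact hG j
end

section
/- There exists a 4-DGDD of type 2^4 (on 8 points partitioned into 4 groups of size 2, necessarily having 8 blocks) whose smallest defining sets contain at least 5 blocks, i.e. at least 5/8 of the blocks. -/
open scoped Classical

/-- The groups `{2i, 2i + 1}` of the point set `Fin 8`. -/
def pairGroups : Multiset (Finset (Fin 8)) := {{0, 1}, {2, 3}, {4, 5}, {6, 7}}

/-- A `4`-DGDD of type `2⁴` with smallest defining sets of size at least five. -/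
def hardBlocks : Multiset (List (Fin 8)) :=
  {[0, 5, 2, 6], [0, 4, 7, 3], [6, 2, 4, 0], [3, 7, 5, 0],
    [1, 2, 5, 7], [7, 4, 2, 1], [6, 5, 1, 3], [3, 1, 4, 6]}

/-- Decidable criterion for being a `4`-DGDD, with computable decidability instances. -/
theorem isDGDD_of_decidable {β : Type*} [DecidableEq β]
    {Gs : Multiset (Finset β)} {B : Multiset (List β)}
    (hG : ∀ x : β, Gs.countP (fun G => x ∈ G) = 1)
    (hB : ∀ b ∈ B, b.Nodup ∧ b.length = 4)
    (hBG : ∀ b ∈ B, ∀ G ∈ Gs, (b.toFinset ∩ G).card ≤ 1)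
    (hpair : ∀ x y : β, x ≠ y → (∀ G ∈ Gs, ¬(x ∈ G ∧ y ∈ G)) →
      B.countP (fun b => [x, y].Sublist b) = 1) :
    IsDGDD Gs B := by
  refine ⟨fun x => ?_, hB, fun b hb G hG' => ?_, fun x y hxy h => ?_⟩
  · convert hG x
  · convert hBG b hb G hG'
  · convert hpair x y hxy h

/-- A defining set of a DGDD meets every pair of blocks that can be traded. -/
theorem IsDGDDDefiningSet.mem_or_mem_of_trade {β : Type*} {Gs : Multiset (Finset β)}
    {B S R : Multiset (List β)} (hS : IsDGDDDefiningSet Gs B S) (a b a' b' : List β)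
    (hB : B = a ::ₘ b ::ₘ R) (hB' : IsDGDD Gs (a' ::ₘ b' ::ₘ R))
    (hne : a' ∉ B) : a ∈ S ∨ b ∈ S := by
  by_contra! h
  obtain ⟨ha, hb⟩ := h
  have hSR : S ≤ R :=
    (Multiset.le_cons_of_notMem hb).1 ((Multiset.le_cons_of_notMem ha).1 (hB ▸ hS.1))
  refine hne ?_
  rw [← hS.2 _ hB' (hSR.trans ((Multiset.le_cons_self _ _).trans (Multiset.le_cons_self _ _)))]
  exact Multiset.mem_cons_self _ _

theorem isDGDD_hardBlocks : IsDGDD pairGroups hardBlocks :=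
  isDGDD_of_decidable (by decide +kernel) (by decide +kernel) (by decide +kernel)
    (by decide +kernel)

/-- Trading two blocks of `hardBlocks`: the defining set contains one of them. -/
theorem mem_or_mem_of_hardBlocks_trade {S : Multiset (List (Fin 8))}
    (hS : IsDGDDDefiningSet pairGroups hardBlocks S) (a b a' b' : List (Fin 8))
    (h : hardBlocks = a ::ₘ b ::ₘ (hardBlocks.erase a).erase b ∧ a' ∉ hardBlocks ∧
      (∀ c ∈ a' ::ₘ b' ::ₘ (hardBlocks.erase a).erase b, c.Nodup ∧ c.length = 4) ∧
      (∀ c ∈ a' ::ₘ b' ::ₘ (hardBlocks.erase a).erase b, ∀ G ∈ pairGroups,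
        (c.toFinset ∩ G).card ≤ 1) ∧
      ∀ x y : Fin 8, x ≠ y → (∀ G ∈ pairGroups, ¬(x ∈ G ∧ y ∈ G)) →
        (a' ::ₘ b' ::ₘ (hardBlocks.erase a).erase b).countP (fun c => [x, y].Sublist c) = 1) :
    1 ≤ S.count a + S.count b := by
  have := hS.mem_or_mem_of_trade a b a' b' h.1
    (isDGDD_of_decidable (by decide +kernel) h.2.2.1 h.2.2.2.1 h.2.2.2.2) h.2.1
  rw [← Multiset.one_le_count_iff_mem, ← Multiset.one_le_count_iff_mem] at this
  omega

theorem sum_count_hardBlocks_le (S : Multiset (List (Fin 8))) :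
    ∑ b ∈ hardBlocks.toFinset, S.count b ≤ S.card := by
  calc ∑ b ∈ hardBlocks.toFinset, S.count b
      ≤ ∑ b ∈ hardBlocks.toFinset ∪ S.toFinset, S.count b :=
        Finset.sum_le_sum_of_subset Finset.subset_union_left
    _ = S.card := Multiset.sum_count_eq_card fun a ha =>
        Finset.mem_union_right _ (Multiset.mem_toFinset.2 ha)

/-- There is a `4`-DGDD of type `2⁴` (8 points, 4 groups of
size 2, 8 blocks) whose every defining set contains at least 5 blocks, i.e. at
least `5/8` of the blocks. -/
theorem stmt19 :
    ∃ (Gs : Multiset (Finset (Fin 8))) (B : Multiset (List (Fin 8))),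
      IsDGDD Gs B ∧ Multiset.card Gs = 4 ∧ (∀ G ∈ Gs, G.card = 2) ∧
      Multiset.card B = 8 ∧
      ∀ S : Multiset (List (Fin 8)), IsDGDDDefiningSet Gs B S →
        5 ≤ Multiset.card S := by
  refine ⟨pairGroups, hardBlocks, isDGDD_hardBlocks, rfl, by decide +kernel, rfl, fun S hS => ?_⟩
  have h03 := mem_or_mem_of_hardBlocks_trade hS [0, 5, 2, 6] [3, 7, 5, 0] [5, 0, 2, 6] [3, 7, 0, 5]
    (by decide +kernel)
  have h04 := mem_or_mem_of_hardBlocks_trade hS [0, 5, 2, 6] [1, 2, 5, 7] [0, 2, 5, 6] [1, 5, 2, 7]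
    (by decide +kernel)
  have h34 := mem_or_mem_of_hardBlocks_trade hS [3, 7, 5, 0] [1, 2, 5, 7] [3, 5, 7, 0] [1, 2, 7, 5]
    (by decide +kernel)
  have h12 := mem_or_mem_of_hardBlocks_trade hS [0, 4, 7, 3] [6, 2, 4, 0] [4, 0, 7, 3] [6, 2, 0, 4]
    (by decide +kernel)
  have h15 := mem_or_mem_of_hardBlocks_trade hS [0, 4, 7, 3] [7, 4, 2, 1] [0, 7, 4, 3] [4, 7, 2, 1]
    (by decide +kernel)
  have h25 := mem_or_mem_of_hardBlocks_trade hS [6, 2, 4, 0] [7, 4, 2, 1] [6, 4, 2, 0] [7, 2, 4, 1]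
    (by decide +kernel)
  have h67 := mem_or_mem_of_hardBlocks_trade hS [6, 5, 1, 3] [3, 1, 4, 6] [6, 5, 3, 1] [1, 3, 4, 6]
    (by decide +kernel)
  have hsum := sum_count_hardBlocks_le S
  rw [show hardBlocks.toFinset = {[0, 5, 2, 6], [0, 4, 7, 3], [6, 2, 4, 0], [3, 7, 5, 0],
    [1, 2, 5, 7], [7, 4, 2, 1], [6, 5, 1, 3], [3, 1, 4, 6]}
    from rfl] at hsum
  repeat rw [Finset.sum_insert (by decide)] at hsum
  rw [Finset.sum_singleton] at hsum
  omega
end
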